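/- arXiv:1609.00976 — 3 statements merged into one kernel-verified Lean document; each statement's English description precedes it below -/
import Mathlib

section
/- Let y(x) = p(x)sin(q(x)) for x ∈ I = (0,c], c > 0, where p ∈ C([0,c]) ∩ C¹((0,c]) and q ∈ C¹((0,c]). Suppose 0 < α ≤ 1, l ∈ ℕ, p(x) ≃₁ x^α (log(1/x))^l and q(x) ≃₁ x^{−1} as x → 0⁺. Then the graph Γ_y of y has box dimension d = 2 − (α+1)/2, and Γ_y is Minkowski degenerate with M_*^d(Γ_y) = M^{*d}(Γ_y) = ∞. -/
open MeasureTheory Filter Metric Set Topology ENNReal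

noncomputable section

/-- The Euclidean plane `ℝ²`. -/
abbrev E2 := EuclideanSpace ℝ (Fin 2)

/-- The point of the Euclidean plane with coordinates `a`, `b`. -/
def pt (a b : ℝ) : E2 := (WithLp.equiv 2 (Fin 2 → ℝ)).symm ![a, b]

/-- The lower `s`-dimensional Minkowski content of `A ⊆ ℝ²`:
`liminf_{ε→0⁺} |A_ε| / ε^(2-s)`, where `A_ε` is the open `ε`-neighbourhood of `A`. -/
def lowerMink (s : ℝ) (A : Set E2) : ℝ≥0∞ :=
  Filter.liminf (fun ε : ℝ => volume (Metric.thickening ε A) / ENNReal.ofReal (ε ^ (2 - s)))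
    (𝓝[>] (0:ℝ))

/-- The upper `s`-dimensional Minkowski content of `A ⊆ ℝ²`. -/
def upperMink (s : ℝ) (A : Set E2) : ℝ≥0∞ :=
  Filter.limsup (fun ε : ℝ => volume (Metric.thickening ε A) / ENNReal.ofReal (ε ^ (2 - s)))
    (𝓝[>] (0:ℝ))

/-- The lower box dimension of `A ⊆ ℝ²`. -/
def lowerDimB (A : Set E2) : ℝ := sInf {s : ℝ | 0 ≤ s ∧ lowerMink s A = 0}

/-- The upper box dimension of `A ⊆ ℝ²`. -/
def upperDimB (A : Set E2) : ℝ := sInf {s : ℝ | 0 ≤ s ∧ upperMink s A = 0}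

/-- The box dimension of `A` exists and equals `d`. -/
def dimBEq (A : Set E2) (d : ℝ) : Prop := lowerDimB A = d ∧ upperDimB A = d

/-- `A` is Minkowski nondegenerate for the dimension `d`:
`0 < M_*^d(A) ≤ M^{*d}(A) < ∞`. -/
def minkNondeg (A : Set E2) (d : ℝ) : Prop := 0 < lowerMink d A ∧ upperMink d A < ⊤

/-- `A` is Minkowski measurable with `d`-dimensional Minkowski content the value `v ∈ (0,∞)`. -/
def minkMeasurableWith (A : Set E2) (d v : ℝ) : Prop :=
  0 < v ∧ lowerMink d A = ENNReal.ofReal v ∧ upperMink d A = ENNReal.ofReal v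

/-- The graph of `g` over `S ⊆ ℝ`, as a subset of the plane. -/
def graphOn (g : ℝ → ℝ) (S : Set ℝ) : Set E2 := (fun t => pt t (g t)) '' S

/-- The curve `τ ↦ (X τ, Y τ)`, `τ ≥ τ₀`, as a subset of the plane. -/
def curveFrom (X Y : ℝ → ℝ) (τ₀ : ℝ) : Set E2 := (fun τ => pt (X τ) (Y τ)) '' Set.Ici τ₀

/-- The radial `ε`-neighbourhood of `A ⊆ ℝ²`: the set of points `y` whose distance to
`A ∩ {t • y : t ≥ 0}` is `< ε`. -/
def rayNbhd (ε : ℝ) (A : Set E2) : Set E2 :=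
  {y | ∃ z ∈ A, (∃ t : ℝ, 0 ≤ t ∧ z = t • y) ∧ dist y z < ε}

/-- The radial lower `s`-dimensional Minkowski content. -/
def radLowerMink (s : ℝ) (A : Set E2) : ℝ≥0∞ :=
  Filter.liminf (fun ε : ℝ => volume (rayNbhd ε A) / ENNReal.ofReal (ε ^ (2 - s))) (𝓝[>] (0:ℝ))

/-- The radial upper `s`-dimensional Minkowski content. -/
def radUpperMink (s : ℝ) (A : Set E2) : ℝ≥0∞ :=
  Filter.limsup (fun ε : ℝ => volume (rayNbhd ε A) / ENNReal.ofReal (ε ^ (2 - s))) (𝓝[>] (0:ℝ))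

/-- The radial lower box dimension. -/
def radLowerDimB (A : Set E2) : ℝ := sInf {s : ℝ | 0 ≤ s ∧ radLowerMink s A = 0}

/-- The radial upper box dimension. -/
def radUpperDimB (A : Set E2) : ℝ := sInf {s : ℝ | 0 ≤ s ∧ radUpperMink s A = 0}

/-- The radial box dimension of `A` exists and equals `d`. -/
def radDimBEq (A : Set E2) (d : ℝ) : Prop := radLowerDimB A = d ∧ radUpperDimB A = d

/-- The spiral `r = f(φ)` in polar coordinates, over the set of angles `S`. -/
def spiralArc (f : ℝ → ℝ) (S : Set ℝ) : Set E2 :=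
  (fun φ => pt (f φ * Real.cos φ) (f φ * Real.sin φ)) '' S

/-- `u(x) ≃₁ v(x)` as `x → 0⁺`: `u/v → 1` and `u'/v' → 1` as `x → 0⁺`. -/
def asympOneZero (u v : ℝ → ℝ) : Prop :=
  Tendsto (fun x => u x / v x) (𝓝[>] (0:ℝ)) (𝓝 1) ∧
  Tendsto (fun x => deriv u x / deriv v x) (𝓝[>] (0:ℝ)) (𝓝 1)


lemma pt_meas (A : Set E2) :
    volume A = (volume : Measure (ℝ × ℝ)) {z : ℝ × ℝ | pt z.1 z.2 ∈ A} := by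
  have h1 := (EuclideanSpace.volume_preserving_symm_measurableEquiv_toLp (Fin 2)).symm
  have h2 := (volume_preserving_finTwoArrow ℝ).symm
  have e1 := h1.measure_preimage_equiv A
  rw [← e1, ← h2.measure_preimage_equiv]
  congr 1

lemma pt_dist (a b a' b' : ℝ) :
    dist (pt a b) (pt a' b') = √((a - a') ^ 2 + (b - b') ^ 2) := by
  rw [EuclideanSpace.dist_eq]
  simp [pt, Fin.sum_univ_two, Real.dist_eq, sq_abs]

lemma pt_dist_fst (a b a' b' : ℝ) : |a - a'| ≤ dist (pt a b) (pt a' b') := by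
  rw [pt_dist]
  apply Real.abs_le_sqrt
  nlinarith [sq_nonneg (b - b')]

lemma pt_dist_snd (a b a' b' : ℝ) : |b - b'| ≤ dist (pt a b) (pt a' b') := by
  rw [pt_dist]
  apply Real.abs_le_sqrt
  nlinarith [sq_nonneg (a - a')]

lemma pt_dist_hor (a a' b : ℝ) : dist (pt a b) (pt a' b) = |a - a'| := by
  rw [pt_dist]
  simp [Real.sqrt_sq_eq_abs]

lemma pt_continuous : Continuous (fun z : ℝ × ℝ => pt z.1 z.2) := by
  unfold pt
  refine (PiLp.continuous_toLp 2 _).comp ?_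
  refine continuous_pi fun i => ?_
  fin_cases i <;> simp <;> fun_prop

/-- Upper estimate of the neighbourhood. -/
lemma upper_est (c C β : ℝ) (hc : 0 < c) (hC : 0 ≤ C) (hβ : 0 < β) (hβ1 : β < 1)
    (y y' : ℝ → ℝ) (hy : ∀ t ∈ Ioc 0 c, HasDerivAt y (y' t) t)
    (hb : ∀ t ∈ Ioc 0 c, |y t| ≤ C * t ^ β)
    (hb' : ∀ t ∈ Ioc 0 c, |y' t| ≤ C * t ^ (β - 2)) (r : ℝ) (hr : 0 < r) (hr2 : r ≤ 1 / 2) :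
    volume (Metric.thickening (r ^ 2) (_root_.graphOn y (Ioc 0 c))) ≤
      ENNReal.ofReal ((4 * (1 + 2 * C) + 2 * (c + 1) + 8 * C / (1 - β)) * r ^ (β + 1)) := by
  set ε := r ^ 2 with hε
  have hεpos : 0 < ε := by positivity
  have hεr : 2 * ε ≤ r := by nlinarith
  set S : Set (ℝ × ℝ) := {z | pt z.1 z.2 ∈ Metric.thickening ε (_root_.graphOn y (Ioc 0 c))} with hS
  have hSm : MeasurableSet S :=
    (Metric.isOpen_thickening.preimage pt_continuous).measurableSet
  have hmem : ∀ u v, (u, v) ∈ S → ∃ t ∈ Ioc 0 c, |u - t| < ε ∧ |v - y t| < ε := by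
    intro u v h
    obtain ⟨z, ⟨t, ht, rfl⟩, hz⟩ := Metric.mem_thickening_iff.1 h
    exact ⟨t, ht, (pt_dist_fst _ _ _ _).trans_lt hz, (pt_dist_snd _ _ _ _).trans_lt hz⟩
  rw [pt_meas, Measure.volume_eq_prod, Measure.prod_apply hSm]
  set h := ε + C * (2 * r ^ β) with hh
  have h2β : (2:ℝ) ^ β ≤ 2 := by
    calc (2:ℝ) ^ β ≤ 2 ^ (1:ℝ) := Real.rpow_le_rpow_of_exponent_le (by norm_num) hβ1.le
      _ = 2 := by simp
  set k : ℝ → ℝ := fun u => 2 * ε + 8 * ε * C * u ^ (β - 2) with hk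
  have key : ∀ u, volume (Prod.mk u ⁻¹' S) ≤
      (Icc (-r) r).indicator (fun _ => ENNReal.ofReal (2 * h)) u +
      (Ioc r (c + 1)).indicator (fun u => ENNReal.ofReal (k u)) u := by
    intro u
    by_cases h1 : u ∈ Icc (-r) r
    · rw [indicator_of_mem h1]
      refine le_trans ?_ le_self_add
      have : Prod.mk u ⁻¹' S ⊆ Icc (-h) h := by
        intro v hv
        obtain ⟨t, ht, h3, h4⟩ := hmem u v hv
        have h5 : |y t| ≤ C * (2 * r ^ β) := by
          refine (hb t ht).trans (mul_le_mul_of_nonneg_left ?_ hC)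
          have : t ≤ 2 * r := by
            have := (abs_lt.1 h3).1; linarith [h1.2]
          calc t ^ β ≤ (2 * r) ^ β := Real.rpow_le_rpow ht.1.le this hβ.le
            _ = 2 ^ β * r ^ β := Real.mul_rpow (by norm_num) hr.le
            _ ≤ 2 * r ^ β := by gcongr
        rw [abs_lt] at h4; rw [abs_le] at h5
        constructor <;> linarith [h4.1, h4.2, h5.1, h5.2]
      refine (measure_mono this).trans ?_
      rw [Real.volume_Icc]
      apply ENNReal.ofReal_le_ofReal; linarith
    by_cases h2 : u ∈ Ioc r (c + 1)
    · rw [indicator_of_mem h2]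
      refine le_trans ?_ le_add_self
      have hu : 0 < u := hr.trans h2.1
      set w := ε + ε * (4 * C * u ^ (β - 2)) with hw
      have : Prod.mk u ⁻¹' S ⊆ Icc (y (min u c) - w) (y (min u c) + w) := by
        intro v hv
        obtain ⟨t, ht, h3, h4⟩ := hmem u v hv
        have ht2 : u / 2 ≤ t := by
          have := (abs_lt.1 h3).2; linarith [h2.1]
        have h5 : |t - min u c| ≤ ε := by
          rcases le_total u c with h | h
          · rw [min_eq_left h, abs_sub_comm]; exact h3.le
          · rw [min_eq_right h]; rw [abs_lt] at h3; rw [abs_le]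
            constructor <;> linarith [h3.1, h3.2, ht.2]
        have h6 : ‖y t - y (min u c)‖ ≤ (4 * C * u ^ (β - 2)) * ‖t - min u c‖ := by
          refine Convex.norm_image_sub_le_of_norm_hasDerivWithin_le (f := y) (f' := y')
            (s := Icc (u / 2) c) ?_ ?_ (convex_Icc _ _) ?_ ⟨ht2, ht.2⟩
          · intro x hx
            exact (hy x ⟨by linarith [hx.1], hx.2⟩).hasDerivWithinAt
          · intro x hx
            have hx0 : 0 < x := by linarith [hx.1]
            refine (hb' x ⟨hx0, hx.2⟩).trans ?_
            have e1 : x ^ (β - 2) ≤ (u / 2) ^ (β - 2) :=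
              Real.rpow_le_rpow_of_nonpos (by linarith) hx.1 (by linarith)
            have e2 : (u / 2) ^ (β - 2) ≤ 4 * u ^ (β - 2) := by
              rw [Real.div_rpow hu.le (by norm_num), div_eq_mul_inv,
                ← Real.rpow_neg (by norm_num), mul_comm]
              gcongr
              calc (2:ℝ) ^ (-(β - 2)) ≤ 2 ^ (2:ℝ) :=
                    Real.rpow_le_rpow_of_exponent_le (by norm_num) (by linarith)
                _ = 4 := by norm_num
            calc C * x ^ (β - 2) ≤ C * (4 * u ^ (β - 2)) := by
                  gcongr; exact e1.trans e2
              _ = _ := by ring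
          · refine ⟨le_min (by linarith) (ht2.trans ht.2), min_le_right _ _⟩
        rw [Real.norm_eq_abs, Real.norm_eq_abs] at h6
        have hnn : 0 ≤ 4 * C * u ^ (β - 2) := by positivity
        have h7 : |y t - y (min u c)| ≤ ε * (4 * C * u ^ (β - 2)) := by
          refine h6.trans ?_
          rw [mul_comm]; gcongr
        rw [abs_lt] at h4; rw [abs_le] at h7
        constructor <;> linarith [h4.1, h4.2, h7.1, h7.2]
      refine (measure_mono this).trans ?_
      rw [Real.volume_Icc]
      apply ENNReal.ofReal_le_ofReal
      simp only [hk, hw]; linarith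
    · have : Prod.mk u ⁻¹' S = ∅ := by
        rw [eq_empty_iff_forall_notMem]
        intro v hv
        obtain ⟨t, ht, h3, h4⟩ := hmem u v hv
        rw [abs_lt] at h3
        by_cases hur : u ≤ r
        · exact h1 ⟨by linarith [h3.1, ht.1], hur⟩
        · exact h2 ⟨not_le.1 hur, by linarith [h3.2, ht.2]⟩
      rw [this]; simp
  have hI : IntegrableOn (fun u : ℝ => u ^ (β - 2)) (Ioi r) :=
    integrableOn_Ioi_rpow_of_lt (by linarith) hr
  have hI' : IntegrableOn (fun u : ℝ => u ^ (β - 2)) (Ioc r (c + 1)) :=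
    hI.mono_set Ioc_subset_Ioi_self
  have hint : ∫ u in Ioc r (c + 1), u ^ (β - 2) ≤ r ^ (β - 1) / (1 - β) := by
    calc ∫ u in Ioc r (c + 1), u ^ (β - 2) ≤ ∫ u in Ioi r, u ^ (β - 2) := by
          refine setIntegral_mono_set hI ?_ Ioc_subset_Ioi_self.eventuallyLE
          filter_upwards [ae_restrict_mem measurableSet_Ioi] with u hu
          exact Real.rpow_nonneg (hr.trans hu).le _
      _ = r ^ (β - 1) / (1 - β) := by
          rw [integral_Ioi_rpow_of_lt (by linarith) hr,
            show β - 2 + 1 = -(1 - β) by ring, neg_div_neg_eq, show -(1 - β) = β - 1 by ring]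
  have hkint : IntegrableOn k (Ioc r (c + 1)) := by
    refine Integrable.add ?_ (hI'.const_mul _)
    exact integrable_const _
  have hL : ∫⁻ u in Ioc r (c + 1), ENNReal.ofReal (k u) ≤
      ENNReal.ofReal (2 * ε * (c + 1) + 8 * ε * C * (r ^ (β - 1) / (1 - β))) := by
    rw [← ofReal_integral_eq_lintegral_ofReal hkint]
    · apply ENNReal.ofReal_le_ofReal
      simp only [hk]
      rw [integral_add (integrable_const _) (hI'.const_mul _),
        integral_const_mul (8 * ε * C)]
      have e1 : ∫ _ in Ioc r (c + 1), 2 * ε ≤ 2 * ε * (c + 1) := by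
        rw [setIntegral_const, measureReal_def, Real.volume_Ioc, smul_eq_mul, mul_comm]
        rw [ENNReal.toReal_ofReal (by linarith)]
        gcongr; linarith
      exact add_le_add e1 (mul_le_mul_of_nonneg_left hint (by positivity))
    · filter_upwards [ae_restrict_mem measurableSet_Ioc] with u hu
      have : 0 < u := hr.trans hu.1
      simp only [hk, Pi.zero_apply]; positivity
  have hrβ : 0 < r ^ (β + 1) := by positivity
  have p1 : r ^ (β + 1) = r ^ β * r := Real.rpow_add_one hr.ne' β
  have p2 : ε * r ^ (β - 1) = r ^ (β + 1) := by
    rw [hε, ← Real.rpow_natCast, ← Real.rpow_add hr]; congr 1; push_cast; ring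
  have p3 : ε ≤ r ^ (β + 1) := by
    rw [hε, ← Real.rpow_natCast]
    exact Real.rpow_le_rpow_of_exponent_ge hr (by linarith) (by push_cast; linarith)
  calc ∫⁻ u, volume (Prod.mk u ⁻¹' S) ≤ _ := lintegral_mono key
    _ = ENNReal.ofReal (2 * h) * ENNReal.ofReal (2 * r)
        + ∫⁻ u in Ioc r (c + 1), ENNReal.ofReal (k u) := by
      rw [lintegral_add_left (measurable_const.indicator measurableSet_Icc),
        lintegral_indicator measurableSet_Icc, lintegral_indicator measurableSet_Ioc,
        setLIntegral_const, Real.volume_Icc]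
      congr 3; ring
    _ ≤ ENNReal.ofReal (2 * h) * ENNReal.ofReal (2 * r) +
      ENNReal.ofReal (2 * ε * (c + 1) + 8 * ε * C * (r ^ (β - 1) / (1 - β))) := by gcongr
    _ ≤ _ := by
      have q1 : 0 < 1 - β := by linarith
      rw [← ENNReal.ofReal_mul (by positivity), ← ENNReal.ofReal_add (by positivity) (by positivity)]
      apply ENNReal.ofReal_le_ofReal
      have e1 : 8 * ε * C * (r ^ (β - 1) / (1 - β)) = 8 * C / (1 - β) * r ^ (β + 1) := by
        rw [← p2]; ring
      have e2 : 2 * h * (2 * r) ≤ 4 * (1 + 2 * C) * r ^ (β + 1) := by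
        have : ε * r ≤ r ^ (β + 1) := by nlinarith
        rw [hh]
        have : 2 * (ε + C * (2 * r ^ β)) * (2 * r) = 4 * (ε * r) + 8 * C * (r ^ β * r) := by ring
        rw [this, ← p1]; linarith
      have e3 : 2 * ε * (c + 1) ≤ 2 * (c + 1) * r ^ (β + 1) := by nlinarith
      rw [e1]; linarith

/-- Lower estimate of the neighbourhood. -/
lemma lower_est (c α M x0 : ℝ) (hα : 0 < α) (hM : 0 ≤ M) (hx0c : x0 ≤ c)
    (p q : ℝ → ℝ) (hpc : ContinuousOn p (Ioc 0 c))
    (hqd : ∀ x ∈ Ioc (0:ℝ) c, DifferentiableAt ℝ q x)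
    (hp : ∀ t ∈ Ioo 0 x0, M * t ^ α ≤ p t)
    (hq : ∀ t ∈ Ioo 0 x0, deriv q t ≤ -(1 / 2) / t ^ 2)
    (r : ℝ) (hr : 0 < r) (hrx : r < x0) (hr1 : r < 1 / 4) :
    ENNReal.ofReal (M * (r / 32) ^ (α + 1)) ≤
      volume (Metric.thickening (r ^ 2)
        (_root_.graphOn (fun x => p x * Real.sin (q x)) (Ioc 0 c))) := by
  set y : ℝ → ℝ := fun x => p x * Real.sin (q x) with hy
  have hqc : ContinuousOn q (Ioc 0 c) := fun x hx => (hqd x hx).continuousAt.continuousWithinAt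
  have hyc : ContinuousOn y (Ioc 0 c) := hpc.mul (Real.continuous_sin.comp_continuousOn hqc)
  have hb : 0 < r / 32 := by positivity
  rw [pt_meas]
  have hsub : Icc (r / 32) (r / 16) ×ˢ Icc 0 (M * (r / 32) ^ α) ⊆
      {z : ℝ × ℝ | pt z.1 z.2 ∈ Metric.thickening (r ^ 2) (_root_.graphOn y (Ioc 0 c))} := by
    rintro ⟨x, v⟩ ⟨hx, hv⟩
    simp only at hx hv
    have hx0 : 0 < x := hb.trans_le hx.1
    set x' := x + 64 * x ^ 2 with hx'
    have hxx' : x < x' := by rw [hx']; nlinarith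
    have hx'2 : x' ≤ 2 * x := by
      have : x ≤ 1 / 64 := by linarith [hx.2]
      rw [hx']; nlinarith
    have hx'0 : x' < x0 := by linarith [hx.2]
    have hIcc : Icc x x' ⊆ Ioc 0 c := fun t ht => ⟨by linarith [ht.1], by linarith [ht.2]⟩
    have hdrop : q x' + 8 ≤ q x := by
      obtain ⟨ξ, hξ, hs⟩ := exists_deriv_eq_slope q hxx' (hqc.mono hIcc)
        (fun t ht => (hqd t (hIcc ⟨ht.1.le, ht.2.le⟩)).differentiableWithinAt)
      have hξ0 : 0 < ξ := hx0.trans hξ.1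
      have h1 := hq ξ ⟨hξ0, hξ.2.trans hx'0⟩
      rw [hs, div_le_div_iff₀ (by linarith) (by positivity)] at h1
      have h2 : x' - x = 64 * x ^ 2 := by rw [hx']; ring
      rw [h2] at h1
      by_contra hcon
      push Not at hcon
      have h3 : ξ ^ 2 ≤ 4 * x ^ 2 := by
        have : ξ ≤ 2 * x := by linarith [hξ.2]
        nlinarith
      have h4 : (q x' - q x) > -8 := by linarith
      have h5 : 0 < ξ ^ 2 := by positivity
      nlinarith
    have hpi : 2 * Real.pi ≤ 8 := by linarith [Real.pi_lt_four]
    have hang : ∀ θ : ℝ, ∃ t ∈ Icc x x', Real.sin (q t) = Real.sin θ := by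
      intro θ
      obtain ⟨φ, hφ, e⟩ := Real.sin_periodic.exists_mem_Ico Real.two_pi_pos θ (q x')
      obtain ⟨t, ht, rfl⟩ := intermediate_value_Icc' hxx'.le (hqc.mono hIcc)
        ⟨hφ.1, by linarith [hφ.2]⟩
      exact ⟨t, ht, e.symm⟩
    obtain ⟨t0, ht0, e0⟩ := hang 0
    obtain ⟨t1, ht1, e1⟩ := hang (Real.pi / 2)
    rw [Real.sin_zero] at e0
    rw [Real.sin_pi_div_two] at e1
    have hu : uIcc t0 t1 ⊆ Icc x x' := uIcc_subset_Icc ht0 ht1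
    have y0 : y t0 = 0 := by simp [hy, e0]
    have y1 : v ≤ y t1 := by
      have : y t1 = p t1 := by simp [hy, e1]
      rw [this]
      refine le_trans (hv.2.trans ?_) (hp t1 ⟨by linarith [ht1.1], by linarith [ht1.2]⟩)
      gcongr
      linarith [ht1.1, hx.1]
    have hvm : v ∈ uIcc (y t0) (y t1) := by
      rw [y0, uIcc_of_le (hv.1.trans y1)]; exact ⟨hv.1, y1⟩
    obtain ⟨t, ht, rfl⟩ := intermediate_value_uIcc (hyc.mono (hu.trans hIcc)) hvm
    have ht' := hu ht
    refine Metric.mem_thickening_iff.2 ⟨pt t (y t), ⟨t, hIcc ht', rfl⟩, ?_⟩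
    simp only [pt_dist_hor]
    rw [abs_lt]
    have : 64 * x ^ 2 < r ^ 2 := by nlinarith [hx.2]
    constructor <;> nlinarith [ht'.1, ht'.2]
  refine le_trans ?_ (measure_mono hsub)
  rw [Measure.volume_eq_prod, Measure.prod_prod, Real.volume_Icc, Real.volume_Icc,
    ← ENNReal.ofReal_mul (by linarith)]
  apply ENNReal.ofReal_le_ofReal
  rw [Real.rpow_add_one hb.ne']
  apply le_of_eq; ring

lemma tendsto_L : Tendsto (fun x : ℝ => Real.log (1 / x)) (𝓝[>] 0) atTop := by
  simp only [one_div, Real.log_inv]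
  exact tendsto_neg_atBot_atTop.comp Real.tendsto_log_nhdsGT_zero

lemma ev_p_lower (α M : ℝ) (l : ℕ) (hl : 1 ≤ l) (p : ℝ → ℝ)
    (h : Tendsto (fun x => p x / (x ^ α * Real.log (1/x) ^ l)) (𝓝[>] (0:ℝ)) (𝓝 1)) :
    ∀ᶠ t in 𝓝[>] (0:ℝ), M * t ^ α ≤ p t := by
  have hL : Tendsto (fun x : ℝ => Real.log (1 / x) ^ l) (𝓝[>] 0) atTop :=
    (tendsto_pow_atTop (by omega)).comp tendsto_L
  filter_upwards [h.eventually (lt_mem_nhds (show (1/2:ℝ) < 1 by norm_num)),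
    hL.eventually_ge_atTop (2 * M), hL.eventually_gt_atTop 0, self_mem_nhdsWithin] with t h1 h2 h3 h4
  have h4' : 0 < t ^ α := Real.rpow_pos_of_pos h4 α
  rw [lt_div_iff₀ (by positivity)] at h1
  nlinarith

lemma ev_q (q : ℝ → ℝ)
    (h : Tendsto (fun x => deriv q x / deriv (fun x : ℝ => x⁻¹) x) (𝓝[>] (0:ℝ)) (𝓝 1)) :
    ∀ᶠ t in 𝓝[>] (0:ℝ), deriv q t ≤ -(1 / 2) / t ^ 2 ∧ |deriv q t| ≤ 2 / t ^ 2 := by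
  filter_upwards [h.eventually (lt_mem_nhds (show (1/2:ℝ) < 1 by norm_num)),
    h.eventually (gt_mem_nhds (show (1:ℝ) < 2 by norm_num)), self_mem_nhdsWithin] with t h1 h2 h4
  have h4' : 0 < t := h4
  rw [deriv_inv] at h1 h2
  have h5 : deriv q t / -(t ^ 2)⁻¹ = -(deriv q t * t ^ 2) := by
    field_simp
  rw [h5] at h1 h2
  have h6 : 0 < t ^ 2 := by positivity
  constructor
  · rw [le_div_iff₀ h6]; linarith
  · rw [le_div_iff₀ h6, ← abs_of_pos h6, ← abs_mul, abs_le]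
    constructor <;> linarith

lemma ev_L (l : ℕ) (δ : ℝ) (hδ : 0 < δ) :
    ∀ᶠ t in 𝓝[>] (0:ℝ), Real.log (1 / t) ^ l ≤ t ^ (-δ) := by
  have h := (isLittleO_abs_log_rpow_rpow_nhdsGT_zero (s := -δ) l (by linarith)).bound one_pos
  filter_upwards [h, self_mem_nhdsWithin] with t h1 h2
  have h2' : 0 < t := h2
  rw [Real.norm_eq_abs, Real.norm_eq_abs, Real.rpow_natCast, abs_of_nonneg (pow_nonneg (abs_nonneg _) l),
    abs_of_nonneg (Real.rpow_nonneg h2'.le _), one_mul] at h1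
  refine le_trans ?_ h1
  rw [one_div, Real.log_inv, ← abs_neg, ← abs_pow]
  exact le_abs_self _

lemma ev_p_upper (α δ : ℝ) (l : ℕ) (hl : 1 ≤ l) (hα : 0 < α) (hδ : 0 < δ) (p : ℝ → ℝ)
    (h : asympOneZero p (fun x => x ^ α * Real.log (1/x) ^ l)) :
    ∀ᶠ t in 𝓝[>] (0:ℝ), |p t| ≤ 2 * t ^ (α - δ) ∧
      |deriv p t| ≤ 2 * (α + l) * t ^ (α - δ - 2) := by
  obtain ⟨ha, hb⟩ := h
  have hE : ∀ {g : ℝ → ℝ}, Tendsto g (𝓝[>] 0) (𝓝 1) → ∀ᶠ t in 𝓝[>] (0:ℝ), |g t| < 2 ∧ g t ≠ 0 := by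
    intro g hg
    filter_upwards [hg.eventually (lt_mem_nhds (show (1/2:ℝ) < 1 by norm_num)),
      hg.eventually (gt_mem_nhds (show (1:ℝ) < 2 by norm_num))] with t h1 h2
    exact ⟨by rw [abs_lt]; constructor <;> linarith, by linarith⟩
  filter_upwards [hE ha, hE hb, ev_L l δ hδ, tendsto_L.eventually_ge_atTop 1,
    self_mem_nhdsWithin, mem_nhdsWithin_of_mem_nhds (gt_mem_nhds (show (0:ℝ) < 1 by norm_num))]
    with t h1 h2 h3 h4 h5 h6
  have h5' : 0 < t := h5
  have h6' : t < 1 := h6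
  set L := Real.log (1 / t) with hL
  have hLp : 0 < L := by linarith
  have htα : 0 < t ^ α := by positivity
  constructor
  · have h1' := h1.1
    rw [abs_div, div_lt_iff₀ (abs_pos.2 (show t ^ α * L ^ l ≠ 0 by positivity)), abs_of_pos (show 0 < t ^ α * L ^ l by positivity)] at h1'
    refine h1'.le.trans ?_
    rw [sub_eq_add_neg, Real.rpow_add h5']
    gcongr
  · have hd : HasDerivAt (fun x : ℝ => x ^ α * Real.log (1/x) ^ l)
        (α * t ^ (α - 1) * L ^ l + t ^ α * (l * L ^ (l - 1) * (-t⁻¹))) t := by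
      have e1 : HasDerivAt (fun x : ℝ => x ^ α) (α * t ^ (α - 1)) t :=
        Real.hasDerivAt_rpow_const (Or.inl h5'.ne')
      have e2 : HasDerivAt (fun x : ℝ => Real.log (1/x)) (-t⁻¹) t := by
        simp only [one_div, Real.log_inv]
        exact (Real.hasDerivAt_log h5'.ne').neg
      exact e1.mul (e2.pow l)
    have hds : |deriv (fun x : ℝ => x ^ α * Real.log (1/x) ^ l) t| ≤
        (α + l) * (t ^ (α - 1) * L ^ l) := by
      rw [hd.deriv]
      have e3 : t ^ α = t ^ (α - 1) * t := by
        rw [← Real.rpow_add_one h5'.ne']; congr 1; ring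
      have e4 : L ^ (l - 1) ≤ L ^ l := pow_le_pow_right₀ h4 (by omega)
      have e5 : t ^ α * (l * L ^ (l - 1) * (-t⁻¹)) = -(l * (t ^ (α - 1) * L ^ (l - 1))) := by
        rw [e3]; field_simp
      rw [e5]
      have e6 : t ^ (α - 1) * L ^ (l - 1) ≤ t ^ (α - 1) * L ^ l := by gcongr
      have e7 : 0 ≤ t ^ (α - 1) * L ^ (l - 1) := by positivity
      have e8 : (l:ℝ) * (t ^ (α - 1) * L ^ (l - 1)) ≤ l * (t ^ (α - 1) * L ^ l) := by gcongr
      have e9 : 0 ≤ (l:ℝ) * (t ^ (α - 1) * L ^ (l - 1)) := by positivity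
      have e10 : 0 ≤ α * (t ^ (α - 1) * L ^ l) := by positivity
      rw [abs_le]
      constructor <;> nlinarith
    have hne : 0 < |deriv (fun x : ℝ => x ^ α * Real.log (1/x) ^ l) t| := by
      rw [abs_pos]
      intro h0
      exact h2.2 (by rw [h0]; exact _root_.div_zero _)
    have h2' := h2.1
    rw [abs_div, div_lt_iff₀ hne] at h2'
    refine h2'.le.trans ?_
    calc 2 * |deriv (fun x : ℝ => x ^ α * Real.log (1/x) ^ l) t|
        ≤ 2 * ((α + l) * (t ^ (α - 1) * L ^ l)) := by gcongr
      _ ≤ 2 * ((α + l) * (t ^ (α - 1) * t ^ (-δ))) := by gcongr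
      _ = 2 * (α + l) * t ^ (α - δ - 1) := by
        rw [← Real.rpow_add h5']; ring_nf
      _ ≤ 2 * (α + l) * t ^ (α - δ - 2) := by
        refine mul_le_mul_of_nonneg_left ?_ (by positivity)
        exact Real.rpow_le_rpow_of_exponent_ge h5' h6'.le (by linarith)

/-- A function continuous on `(0,c]` with a power bound near zero has a power bound. -/
lemma extend_bound (c a C : ℝ) (f : ℝ → ℝ) (hf : ContinuousOn f (Ioc 0 c))
    (h : ∀ᶠ t in 𝓝[>] (0:ℝ), |f t| ≤ C * t ^ a) :
    ∃ C', 0 ≤ C' ∧ ∀ t ∈ Ioc 0 c, |f t| ≤ C' * t ^ a := by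
  obtain ⟨x0, hx0, hh⟩ := mem_nhdsGT_iff_exists_Ioo_subset.1 h
  have hx0' : 0 < x0 := hx0
  have hs : Icc x0 c ⊆ Ioc 0 c := fun t ht => ⟨hx0'.trans_le ht.1, ht.2⟩
  have hcont : ContinuousOn (fun t => f t / t ^ a) (Icc x0 c) := by
    refine (hf.mono hs).div ?_ ?_
    · intro t ht
      exact (Real.continuousAt_rpow_const t a (Or.inl (hs ht).1.ne')).continuousWithinAt
    · intro t ht
      exact (Real.rpow_pos_of_pos (hs ht).1 a).ne'
  obtain ⟨D, hD⟩ := isCompact_Icc.exists_bound_of_continuousOn hcont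
  refine ⟨max (max C D) 0, le_max_right _ _, fun t ht => ?_⟩
  have hta : 0 < t ^ a := Real.rpow_pos_of_pos ht.1 a
  rcases lt_or_ge t x0 with h1 | h1
  · refine (hh ⟨ht.1, h1⟩ : |f t| ≤ C * t ^ a).trans ?_
    gcongr
    exact (le_max_left _ _).trans (le_max_left _ _)
  · have := hD t ⟨h1, ht.2⟩
    rw [Real.norm_eq_abs, abs_div, abs_of_pos hta, div_le_iff₀ hta] at this
    refine this.trans ?_
    gcongr
    exact (le_max_right _ _).trans (le_max_left _ _)

/-- **Theorem (box dimension and Minkowski degeneracy of the graph of a logarithmic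
`(α,1)`-chirp-like function)**: for `y(x) = p(x) sin(q(x))` on `(0,c]` with
`p ≃₁ x^α (log(1/x))^l` and `q ≃₁ x⁻¹` as `x → 0⁺`, `0 < α ≤ 1`, `l ∈ ℕ`, the graph of `y`
has box dimension `d = 2 - (α+1)/2` and is Minkowski degenerate with `M^d = ∞`. -/
theorem box_dimension_log_chirp
    (c α : ℝ) (l : ℕ) (hc : 0 < c) (hα : 0 < α) (hα1 : α ≤ 1) (hl : 1 ≤ l)
    (p q : ℝ → ℝ)
    (hp_cont : ContinuousOn p (Set.Icc 0 c))
    (hp_diff : ∀ x ∈ Set.Ioc (0:ℝ) c, DifferentiableAt ℝ p x)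
    (hp_deriv_cont : ContinuousOn (deriv p) (Set.Ioc 0 c))
    (hq_diff : ∀ x ∈ Set.Ioc (0:ℝ) c, DifferentiableAt ℝ q x)
    (hq_deriv_cont : ContinuousOn (deriv q) (Set.Ioc 0 c))
    (hp_asymp : asympOneZero p (fun x => x ^ α * Real.log (1/x) ^ l))
    (hq_asymp : asympOneZero q (fun x => x⁻¹)) :
    dimBEq (graphOn (fun x => p x * Real.sin (q x)) (Set.Ioc 0 c)) (2 - (α+1)/2) ∧
    lowerMink (2 - (α+1)/2) (graphOn (fun x => p x * Real.sin (q x)) (Set.Ioc 0 c)) = ⊤ ∧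
    upperMink (2 - (α+1)/2) (graphOn (fun x => p x * Real.sin (q x)) (Set.Ioc 0 c)) = ⊤ := by
  set A := _root_.graphOn (fun x => p x * Real.sin (q x)) (Set.Ioc 0 c) with hA
  have hpc : ContinuousOn p (Ioc 0 c) := hp_cont.mono Ioc_subset_Icc_self
  have hqc : ContinuousOn q (Ioc 0 c) :=
    fun x hx => (hq_diff x hx).continuousAt.continuousWithinAt
  have hlow : ∀ s, s ≤ 2 - (α + 1) / 2 → lowerMink s A = ⊤ := by
    intro s hs
    rw [eq_top_iff]
    refine ENNReal.le_of_forall_nnreal_lt fun N _ => ?_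
    set M : ℝ := N * 32 ^ (α + 1) with hM
    have hM0 : 0 ≤ M := by positivity
    obtain ⟨x1, hx1, hh⟩ := mem_nhdsGT_iff_exists_Ioo_subset.1
      ((ev_p_lower α M l hl p hp_asymp.1).and (ev_q q hq_asymp.2))
    have hx1' : 0 < x1 := hx1
    set x0 := min x1 c with hx0
    have hx0p : 0 < x0 := lt_min hx1' hc
    refine le_liminf_of_le ?_ ?_
    · isBoundedDefault
    have hm : 0 < min x0 (1 / 4) := lt_min hx0p (by norm_num)
    filter_upwards [self_mem_nhdsWithin,
      mem_nhdsWithin_of_mem_nhds (gt_mem_nhds (show (0:ℝ) < (min x0 (1/4)) ^ 2 by positivity))]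
      with ε h1 h2
    have hε : 0 < ε := h1
    have hr : √ε < min x0 (1 / 4) := by
      rw [Real.sqrt_lt' hm]; exact h2
    have hrp : 0 < √ε := Real.sqrt_pos.2 hε
    have hest := lower_est c α M x0 hα hM0 (min_le_right _ _) p q hpc hq_diff
      (fun t ht => (hh ⟨ht.1, ht.2.trans_le (min_le_left _ _)⟩).1)
      (fun t ht => (hh ⟨ht.1, ht.2.trans_le (min_le_left _ _)⟩).2.1)
      (√ε) hrp (hr.trans_le (min_le_left _ _)) (hr.trans_le (min_le_right _ _))
    rw [Real.sq_sqrt hε.le] at hest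
    rw [ENNReal.le_div_iff_mul_le (Or.inl (by simp; positivity)) (Or.inl ENNReal.ofReal_ne_top)]
    refine le_trans ?_ hest
    rw [← ENNReal.ofReal_coe_nnreal, ← ENNReal.ofReal_mul (by positivity)]
    apply ENNReal.ofReal_le_ofReal
    have e1 : M * (√ε / 32) ^ (α + 1) = N * ε ^ ((α + 1) / 2) := by
      rw [Real.div_rpow hrp.le (by norm_num), hM, Real.sqrt_eq_rpow, ← Real.rpow_mul hε.le]
      have : (0:ℝ) < 32 ^ (α + 1) := by positivity
      field_simp
    rw [e1]
    have hε1 : ε ≤ 1 := by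
      have : √ε ≤ 1 := (hr.le.trans (min_le_right _ _)).trans (by norm_num)
      rwa [Real.sqrt_le_iff, and_iff_right zero_le_one, one_pow] at this
    refine mul_le_mul_of_nonneg_left ?_ N.2
    exact Real.rpow_le_rpow_of_exponent_ge hε hε1 (by linarith)
  have hup : ∀ s, 2 - (α + 1) / 2 < s → upperMink s A = 0 := by
    intro s hs
    set δ := min ((α + 1) / 2 - (2 - s)) (α / 2) with hδ
    have hδ0 : 0 < δ := lt_min (by linarith) (by linarith)
    have hδ1 : δ ≤ (α + 1) / 2 - (2 - s) := min_le_left _ _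
    have hδ2 : δ ≤ α / 2 := min_le_right _ _
    set β := α - δ with hβ
    set y : ℝ → ℝ := fun x => p x * Real.sin (q x) with hy
    set y' : ℝ → ℝ := fun x => deriv p x * Real.sin (q x) + p x * (Real.cos (q x) * deriv q x)
      with hy'
    have hyd : ∀ t ∈ Ioc 0 c, HasDerivAt y (y' t) t := fun t ht =>
      (hp_diff t ht).hasDerivAt.mul (hq_diff t ht).hasDerivAt.sin
    have hyc : ContinuousOn y (Ioc 0 c) := hpc.mul (Real.continuous_sin.comp_continuousOn hqc)
    have hyc' : ContinuousOn y' (Ioc 0 c) :=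
      (hp_deriv_cont.mul (Real.continuous_sin.comp_continuousOn hqc)).add
        (hpc.mul ((Real.continuous_cos.comp_continuousOn hqc).mul hq_deriv_cont))
    have hevp := ev_p_upper α δ l hl hα hδ0 p hp_asymp
    have hevy : ∀ᶠ t in 𝓝[>] (0:ℝ), |y t| ≤ 2 * t ^ β := by
      filter_upwards [hevp] with t ht
      rw [hy]
      simp only [abs_mul]
      calc |p t| * |Real.sin (q t)| ≤ |p t| * 1 := by gcongr; exact Real.abs_sin_le_one _
        _ ≤ _ := by rw [mul_one]; exact ht.1
    have hevy' : ∀ᶠ t in 𝓝[>] (0:ℝ), |y' t| ≤ (2 * (α + l) + 4) * t ^ (β - 2) := by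
      filter_upwards [hevp, ev_q q hq_asymp.2, self_mem_nhdsWithin] with t ht hq' ht0
      have ht0' : 0 < t := ht0
      have e1 : |deriv p t * Real.sin (q t)| ≤ 2 * (α + l) * t ^ (β - 2) := by
        rw [abs_mul]
        calc _ ≤ |deriv p t| * 1 := by gcongr; exact Real.abs_sin_le_one _
          _ ≤ _ := by rw [mul_one]; exact ht.2
      have e2 : |p t * (Real.cos (q t) * deriv q t)| ≤ 4 * t ^ (β - 2) := by
        rw [abs_mul, abs_mul]
        calc _ ≤ (2 * t ^ β) * (1 * (2 / t ^ 2)) := by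
              gcongr
              · exact ht.1
              · exact Real.abs_cos_le_one _
              · exact hq'.2
          _ = _ := by
            have e3 : t ^ (β - 2) = t ^ β / t ^ 2 := by
              rw [Real.rpow_sub ht0' β 2, Real.rpow_ofNat]
            rw [e3]
            ring
      calc |y' t| ≤ _ := abs_add_le _ _
        _ ≤ _ := by linarith
    obtain ⟨C1, hC1, hb1⟩ := extend_bound c β _ y hyc hevy
    obtain ⟨C2, hC2, hb2⟩ := extend_bound c (β - 2) _ y' hyc' hevy'
    set C := max C1 C2 with hC
    have hC0 : 0 ≤ C := hC1.trans (le_max_left _ _)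
    set K := 4 * (1 + 2 * C) + 2 * (c + 1) + 8 * C / (1 - β) with hK
    have hest := upper_est c C β hc hC0 (by linarith) (by linarith) y y' hyd
      (fun t ht => (hb1 t ht).trans (by
        have := Real.rpow_nonneg ht.1.le β
        gcongr; exact le_max_left _ _))
      (fun t ht => (hb2 t ht).trans (by
        have := Real.rpow_nonneg ht.1.le (β - 2)
        gcongr; exact le_max_right _ _))
    set γ := (β + 1) / 2 - (2 - s) with hγ
    have hγ0 : 0 < γ := by rw [hγ, hβ]; linarith
    have hlim : Tendsto (fun ε : ℝ => ENNReal.ofReal (K * ε ^ γ)) (𝓝[>] 0) (𝓝 0) := by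
      have h1 : Tendsto (fun ε : ℝ => K * ε ^ γ) (𝓝 0) (𝓝 (K * 0 ^ γ)) :=
        ((Real.continuousAt_rpow_const 0 γ (Or.inr hγ0.le)).tendsto).const_mul K
      rw [Real.zero_rpow hγ0.ne', mul_zero] at h1
      have h2 := (ENNReal.continuous_ofReal.tendsto 0).comp (h1.mono_left (nhdsWithin_le_nhds (s := Ioi 0)))
      rw [ENNReal.ofReal_zero] at h2
      exact h2
    refine (tendsto_of_tendsto_of_tendsto_of_le_of_le' tendsto_const_nhds hlim
      (Eventually.of_forall fun _ => zero_le) ?_).limsup_eq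
    filter_upwards [self_mem_nhdsWithin,
      mem_nhdsWithin_of_mem_nhds (gt_mem_nhds (show (0:ℝ) < (1/2) ^ 2 by positivity))]
      with ε h1 h2
    have hε : 0 < ε := h1
    have hr : √ε < 1 / 2 := by
      rw [Real.sqrt_lt' (by norm_num)]; exact h2
    have h3 := hest (√ε) (Real.sqrt_pos.2 hε) hr.le
    rw [Real.sq_sqrt hε.le] at h3
    refine ENNReal.div_le_of_le_mul (h3.trans ?_)
    have hβ1 : 0 < 1 - β := by linarith
    rw [← ENNReal.ofReal_mul (by positivity)]
    apply ENNReal.ofReal_le_ofReal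
    rw [mul_assoc, ← Real.rpow_add hε, Real.sqrt_eq_rpow, ← Real.rpow_mul hε.le]
    apply le_of_eq
    congr 2
    rw [hγ]; ring
  have hlu : ∀ s, lowerMink s A ≤ upperMink s A := fun s => liminf_le_limsup
  have hset : ∀ f : ℝ → ℝ≥0∞, (∀ s, s ≤ 2 - (α + 1) / 2 → f s = ⊤) →
      (∀ s, 2 - (α + 1) / 2 < s → f s = 0) →
      sInf {s : ℝ | 0 ≤ s ∧ f s = 0} = 2 - (α + 1) / 2 := by
    intro f h1 h2
    have : {s : ℝ | 0 ≤ s ∧ f s = 0} = Ioi (2 - (α + 1) / 2) := by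
      ext s
      simp only [mem_ofPred_eq, mem_Ioi]
      constructor
      · rintro ⟨_, h3⟩
        by_contra h4
        rw [h1 s (not_lt.1 h4)] at h3
        exact ENNReal.top_ne_zero h3
      · intro h3
        exact ⟨by linarith, h2 s h3⟩
    rw [this, csInf_Ioi]
  have hupt : ∀ s, s ≤ 2 - (α + 1) / 2 → upperMink s A = ⊤ := fun s hs =>
    top_le_iff.1 ((hlow s hs).symm.le.trans (hlu s))
  have hlow0 : ∀ s, 2 - (α + 1) / 2 < s → lowerMink s A = 0 := fun s hs =>
    le_antisymm ((hlu s).trans (hup s hs).le) (zero_le)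
  exact ⟨⟨hset _ hlow hlow0, hset _ hupt hup⟩, hlow _ le_rfl, hupt _ le_rfl⟩
end
end

section
/- Let f : [φ₁,∞) → (0,∞), with φ₁ > e, be a measurable, radially decreasing function. Let α ∈ (0,1) and l ∈ ℕ, and suppose there are positive constants m̲, m̄, a̲, ā such that for all φ ≥ φ₁: m̲ φ^{−α} (log φ)^l ≤ f(φ) ≤ m̄ φ^{−α} (log φ)^l, and a̲ φ^{−α−1} (log φ)^l ≤ f(φ) − f(φ+2π) ≤ ā φ^{−α−1} (log φ)^l. Let Γ be the graph of r = f(φ) in polar coordinates and d := 2/(1+α). Then the radial box dimension dim_B(Γ, rad) exists and equals d, and M^{*d}(Γ, rad) = +∞. -/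
open MeasureTheory Filter Metric Set Topology ENNReal

noncomputable section

lemma pt_norm (r θ : ℝ) : ‖pt (r * Real.cos θ) (r * Real.sin θ)‖ = |r| := by
  have h : r ^ 2 * Real.cos θ ^ 2 + r ^ 2 * Real.sin θ ^ 2 = r ^ 2 := by
    rw [← mul_add, Real.cos_sq_add_sin_sq, mul_one]
  simp [pt, EuclideanSpace.norm_eq, Fin.sum_univ_two, mul_pow, h, Real.sqrt_sq_eq_abs]

lemma pt_smul (t a b : ℝ) : t • pt a b = pt (t * a) (t * b) := by
  ext i; fin_cases i <;> simp [pt]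

lemma pt_sub (a b c d : ℝ) : pt a b - pt c d = pt (a - c) (b - d) := by
  ext i; fin_cases i <;> simp [pt]

lemma pt_dist_s11 (r s θ : ℝ) :
    dist (pt (r * Real.cos θ) (r * Real.sin θ)) (pt (s * Real.cos θ) (s * Real.sin θ)) = |r - s| := by
  rw [dist_eq_norm, pt_sub, ← sub_mul, ← sub_mul, pt_norm]

lemma exists_polar (y : E2) : ∃ θ : ℝ, y = pt (‖y‖ * Real.cos θ) (‖y‖ * Real.sin θ) := by
  let z : ℂ := ⟨y 0, y 1⟩
  have hz : ‖z‖ = ‖y‖ := by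
    rw [EuclideanSpace.norm_eq, Complex.norm_eq_sqrt_sq_add_sq]
    simp [z, Fin.sum_univ_two]
  refine ⟨z.arg, ?_⟩
  rw [← hz, Complex.norm_mul_cos_arg, Complex.norm_mul_sin_arg]
  ext i; fin_cases i <;> simp [pt, z]

lemma volume_polar_image (S : Set (ℝ × ℝ)) (hS : MeasurableSet S) :
    volume ((fun p : ℝ × ℝ => pt (p.1 * Real.cos p.2) (p.1 * Real.sin p.2)) '' S)
      ≤ ∫⁻ p in S, ENNReal.ofReal |p.1| := by
  have h1 := addHaar_image_le_lintegral_abs_det_fderiv (volume : Measure (ℝ × ℝ)) hS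
    (fun p _ => (hasFDerivAt_polarCoord_symm p).hasFDerivWithinAt)
  simp_rw [det_fderivPolarCoordSymm] at h1
  refine le_trans (le_of_eq ?_) h1
  have hmp : MeasurePreserving
      ((MeasurableEquiv.finTwoArrow (α := ℝ)).symm.trans (MeasurableEquiv.toLp 2 (Fin 2 → ℝ))) :=
    (volume_preserving_finTwoArrow ℝ).symm.trans (PiLp.volume_preserving_toLp (Fin 2))
  rw [← hmp.measure_preimage_equiv, ← MeasurableEquiv.image_symm, Set.image_image]
  congr 1

/-- the nucleus: a punctured ball is inside the radial neighbourhood. -/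
lemma nucleus_subset (φ₁ Φ ε R : ℝ) (f : ℝ → ℝ) (hΦ : φ₁ ≤ Φ)
    (h0 : ∀ θ ≥ Φ, ∀ r > 0, ∃ k : ℕ, f (θ + 2 * Real.pi * k) < r)
    (hd : ∀ θ ≥ Φ, f θ - f (θ + 2 * Real.pi) < ε)
    (hpos : ∀ θ ≥ φ₁, 0 < f θ)
    (hR : ∀ θ, Φ ≤ θ → θ < Φ + 2 * Real.pi → R ≤ f θ) :
    ball (0 : E2) R \ {0} ⊆ rayNbhd ε (spiralArc f (Set.Ici φ₁)) := by
  rintro y ⟨hy, hy0⟩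
  have hyn : 0 < ‖y‖ := norm_pos_iff.mpr hy0
  have hyR : ‖y‖ < R := by simpa using hy
  obtain ⟨θ₀, hθ₀⟩ := exists_polar y
  obtain ⟨n, hn, -⟩ := existsUnique_add_zsmul_mem_Ico Real.two_pi_pos θ₀ Φ
  simp only [zsmul_eq_mul] at hn
  set θ := θ₀ + n * (2 * Real.pi) with hθ
  have hyθ : y = pt (‖y‖ * Real.cos θ) (‖y‖ * Real.sin θ) := by
    rw [hθ, Real.cos_add_int_mul_two_pi, Real.sin_add_int_mul_two_pi]; exact hθ₀
  classical
  have hex := h0 θ hn.1 ‖y‖ hyn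
  obtain ⟨k, hk, hmin⟩ : ∃ k : ℕ, f (θ + 2 * Real.pi * k) < ‖y‖ ∧
      ∀ j < k, ¬ f (θ + 2 * Real.pi * j) < ‖y‖ :=
    ⟨Nat.find hex, Nat.find_spec hex, fun j hj => Nat.find_min hex hj⟩
  have hπ := Real.pi_pos
  cases k with
  | zero =>
    have := hR θ hn.1 hn.2
    simp at hk
    linarith
  | succ k =>
    have h1 := hmin k (Nat.lt_succ_self k)
    have hk0 : 0 ≤ 2 * Real.pi * (k : ℝ) := by positivity
    have h2 := hd (θ + 2 * Real.pi * k) (by linarith [hn.1])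
    have e : θ + 2 * Real.pi * ((k + 1 : ℕ) : ℝ) = θ + 2 * Real.pi * k + 2 * Real.pi := by
      push_cast; ring
    rw [e] at hk
    set ψ := θ + 2 * Real.pi * k + 2 * Real.pi with hψ
    have hψ1 : φ₁ ≤ ψ := by linarith [hn.1]
    have hyψ : y = pt (‖y‖ * Real.cos ψ) (‖y‖ * Real.sin ψ) := by
      have : ψ = θ + ((k + 1 : ℕ) : ℝ) * (2 * Real.pi) := by rw [hψ]; push_cast; ring
      rw [this, Real.cos_add_nat_mul_two_pi, Real.sin_add_nat_mul_two_pi]; exact hyθ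
    refine ⟨pt (f ψ * Real.cos ψ) (f ψ * Real.sin ψ), ⟨ψ, hψ1, rfl⟩, ⟨f ψ / ‖y‖, ?_, ?_⟩, ?_⟩
    · exact div_nonneg (hpos ψ hψ1).le hyn.le
    · conv_rhs => rw [hyψ]
      rw [pt_norm, abs_of_pos hyn, pt_smul, ← mul_assoc, ← mul_assoc, div_mul_cancel₀ _ hyn.ne']
    · rw [hyψ, pt_dist_s11, abs_lt]
      constructor <;> linarith

lemma volume_nucleus (R : ℝ) : volume (ball (0 : E2) R \ {0}) = ENNReal.ofReal R ^ 2 * ENNReal.ofReal Real.pi := by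
  rw [measure_sdiff_null (by simp)]
  simp [EuclideanSpace.volume_ball_fin_two]

lemma integral_rpow_bound (β a Φ : ℝ) (h1 : β < 1) (ha : 0 < a) :
    ∫⁻ θ in Set.Icc a Φ, ENNReal.ofReal (θ ^ (-β)) ≤ ENNReal.ofReal (Φ ^ (1 - β) / (1 - β)) := by
  rcases le_total Φ a with h | h
  · have : volume (Set.Icc a Φ) = 0 := by simp [h]
    rw [Measure.restrict_eq_zero.mpr this]; simp
  have hint : IntervalIntegrable (fun θ : ℝ => θ ^ (-β)) volume a Φ := by
    apply intervalIntegral.intervalIntegrable_rpow'; linarith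
  rw [intervalIntegrable_iff_integrableOn_Icc_of_le h] at hint
  rw [← ofReal_integral_eq_lintegral_ofReal hint]
  · apply ENNReal.ofReal_le_ofReal
    rw [integral_Icc_eq_integral_Ioc, ← intervalIntegral.integral_of_le h,
      integral_rpow (Or.inl (by linarith))]
    have e : -β + 1 = 1 - β := by ring
    rw [e]
    have := Real.rpow_nonneg ha.le (1 - β)
    apply div_le_div_of_nonneg_right _ (by linarith)
    linarith
  · refine (ae_restrict_mem measurableSet_Icc).mono fun x hx => ?_
    exact Real.rpow_nonneg (ha.le.trans hx.1) _

lemma tube_bound (a Φ ε C β : ℝ) (f : ℝ → ℝ) (hf : Measurable f) (hε : 0 < ε)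
    (ha : 0 < a) (hβ : β < 1) (hC : 0 ≤ C)
    (hpos : ∀ θ ∈ Set.Icc a Φ, 0 < f θ)
    (hb : ∀ θ ∈ Set.Icc a Φ, f θ + ε ≤ C * θ ^ (-β)) :
    volume ((fun p : ℝ × ℝ => pt (p.1 * Real.cos p.2) (p.1 * Real.sin p.2)) ''
      {p : ℝ × ℝ | p.2 ∈ Set.Icc a Φ ∧ |p.1 - f p.2| < ε})
      ≤ ENNReal.ofReal (2 * ε * C * (Φ ^ (1 - β) / (1 - β))) := by
  set S := {p : ℝ × ℝ | p.2 ∈ Set.Icc a Φ ∧ |p.1 - f p.2| < ε} with hSdef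
  have hS : MeasurableSet S := by
    apply MeasurableSet.inter
    · exact measurable_snd measurableSet_Icc
    · exact measurableSet_lt (f := fun p : ℝ × ℝ => |p.1 - f p.2|)
        (continuous_abs.measurable.comp (measurable_fst.sub (hf.comp measurable_snd))) measurable_const
  refine (volume_polar_image S hS).trans ?_
  rw [← lintegral_indicator hS, Measure.volume_eq_prod, lintegral_prod_symm]
  swap
  · exact (Measurable.indicator (by fun_prop) hS).aemeasurable
  calc ∫⁻ y, ∫⁻ x, S.indicator (fun p => ENNReal.ofReal |p.1|) (x, y)
      ≤ ∫⁻ y, (Set.Icc a Φ).indicator (fun θ => ENNReal.ofReal (2 * ε * C) * ENNReal.ofReal (θ ^ (-β))) y := by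
        apply lintegral_mono
        intro y
        by_cases hy : y ∈ Set.Icc a Φ
        · simp only [Set.indicator_of_mem hy]
          calc ∫⁻ x, S.indicator (fun p => ENNReal.ofReal |p.1|) (x, y)
              ≤ ∫⁻ x, (ball (f y) ε).indicator (fun _ => ENNReal.ofReal (C * y ^ (-β))) x := by
                apply lintegral_mono
                intro x
                by_cases hx : (x, y) ∈ S
                · have hx' : |x - f y| < ε := hx.2
                  have hxb : x ∈ ball (f y) ε := by simpa [Real.dist_eq] using hx'
                  simp only [Set.indicator_of_mem hx, Set.indicator_of_mem hxb]
                  apply ENNReal.ofReal_le_ofReal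
                  refine le_trans ?_ (hb y hy)
                  have := hpos y hy
                  rw [abs_lt] at hx'
                  rw [abs_le]; constructor <;> linarith
                · simp [Set.indicator_of_notMem hx]
            _ = ENNReal.ofReal (C * y ^ (-β)) * ENNReal.ofReal (2 * ε) := by
                rw [lintegral_indicator_const measurableSet_ball, Real.volume_ball]
            _ ≤ _ := by
                have hy0 : 0 ≤ y ^ (-β) := Real.rpow_nonneg (ha.le.trans hy.1) _
                rw [← ENNReal.ofReal_mul (by positivity), ← ENNReal.ofReal_mul (by positivity)]
                apply ENNReal.ofReal_le_ofReal
                apply le_of_eq; ring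
        · have : ∀ x, (x, y) ∉ S := fun x hx => hy hx.1
          simp [Set.indicator_of_notMem hy, this]
    _ = ENNReal.ofReal (2 * ε * C) * ∫⁻ θ in Set.Icc a Φ, ENNReal.ofReal (θ ^ (-β)) := by
        rw [lintegral_indicator measurableSet_Icc, lintegral_const_mul _ (by fun_prop)]
    _ ≤ _ := by
        rw [ENNReal.ofReal_mul (p := 2 * ε * C) (by positivity)]
        exact mul_le_mul' le_rfl (integral_rpow_bound β a Φ hβ ha)

lemma rayNbhd_subset (φ₁ Φ ε R : ℝ) (f : ℝ → ℝ)
    (hpos : ∀ θ ≥ φ₁, 0 < f θ)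
    (hR : ∀ θ ≥ φ₁, Φ ≤ θ → f θ + ε ≤ R) :
    rayNbhd ε (spiralArc f (Set.Ici φ₁)) ⊆ ball 0 R ∪
     ((fun p : ℝ × ℝ => pt (p.1 * Real.cos p.2) (p.1 * Real.sin p.2)) ''
      {p : ℝ × ℝ | p.2 ∈ Set.Icc φ₁ Φ ∧ |p.1 - f p.2| < ε}) := by
  rintro y ⟨z, ⟨θ, hθ, rfl⟩, ⟨t, ht, hz⟩, hd⟩
  have hθ' : φ₁ ≤ θ := hθ
  have hf := hpos θ hθ'
  dsimp only at hz hd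
  have hnorm := pt_norm (f θ) θ
  rw [abs_of_pos hf] at hnorm
  rcases le_total Φ θ with h | h
  · left
    rw [mem_ball_zero_iff]
    have h1 := hR θ hθ' h
    have h2 := norm_le_norm_add_norm_sub' y (pt (f θ * Real.cos θ) (f θ * Real.sin θ))
    rw [dist_eq_norm] at hd
    linarith
  · right
    have ht0 : t ≠ 0 := by
      rintro rfl
      rw [hz] at hnorm; simp at hnorm; linarith
    have hy : y = pt (t⁻¹ * f θ * Real.cos θ) (t⁻¹ * f θ * Real.sin θ) := by
      rw [mul_assoc, mul_assoc, ← pt_smul, hz, smul_smul, inv_mul_cancel₀ ht0, one_smul]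
    refine ⟨(t⁻¹ * f θ, θ), ⟨⟨hθ', h⟩, ?_⟩, hy.symm⟩
    rw [hy, pt_dist_s11] at hd
    exact hd

lemma powlog_eq (a x : ℝ) (l : ℕ) (hl : 1 ≤ l) (hx : 0 < x) :
    x ^ (-a) * Real.log x ^ l = (Real.log x / x ^ (a / l)) ^ l := by
  have hl' : (l : ℝ) ≠ 0 := by positivity
  rw [div_pow, ← Real.rpow_natCast (x ^ (a / l)), ← Real.rpow_mul hx.le, div_mul_cancel₀ _ hl',
    Real.rpow_neg hx.le]
  field_simp

lemma powlog_tendsto (a : ℝ) (ha : 0 < a) (l : ℕ) (hl : 1 ≤ l) :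
    Tendsto (fun x : ℝ => x ^ (-a) * Real.log x ^ l) atTop (𝓝 0) := by
  have hl' : (0 : ℝ) < l := by positivity
  have h := (isLittleO_log_rpow_atTop (div_pos ha hl')).tendsto_div_nhds_zero.pow l
  rw [zero_pow (by omega)] at h
  refine h.congr' ?_
  filter_upwards [eventually_gt_atTop 0] with x hx
  exact (powlog_eq a x l hl hx).symm

lemma powlog_antitone (a : ℝ) (ha : 0 < a) (l : ℕ) (hl : 1 ≤ l) (x y : ℝ)
    (hx : Real.exp ((a / l)⁻¹) ≤ x) (hxy : x ≤ y) :
    y ^ (-a) * Real.log y ^ l ≤ x ^ (-a) * Real.log x ^ l := by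
  have hl' : (0 : ℝ) < l := by positivity
  have hal : 0 < a / l := div_pos ha hl'
  have hx1 : 1 ≤ x := le_trans (Real.one_le_exp (inv_nonneg.mpr hal.le)) hx
  rw [powlog_eq a x l hl (by linarith), powlog_eq a y l hl (by linarith)]
  apply pow_le_pow_left₀
  · exact div_nonneg (Real.log_nonneg (by linarith)) (Real.rpow_nonneg (by linarith) _)
  · exact Real.log_div_self_rpow_antitoneOn hal hx (hx.trans hxy) hxy

lemma lower_bound
    (φ₁ α : ℝ) (l : ℕ) (hl : 1 ≤ l) (f : ℝ → ℝ)
    (hφ₁ : Real.exp 1 < φ₁)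
    (hα : α ∈ Set.Ioo (0:ℝ) 1)
    (hf_pos : ∀ φ ≥ φ₁, 0 < f φ)
    (mlo mhi ahi : ℝ) (hmlo : 0 < mlo) (hahi : 0 < ahi)
    (hf_bd : ∀ φ ≥ φ₁,
      mlo * φ ^ (-α) * Real.log φ ^ l ≤ f φ ∧ f φ ≤ mhi * φ ^ (-α) * Real.log φ ^ l)
    (hf_diff_bd : ∀ φ ≥ φ₁,
      f φ - f (φ + 2 * Real.pi) ≤ ahi * φ ^ (-α-1) * Real.log φ ^ l) (M : ℝ) (hM : 0 ≤ M) :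
    ∀ᶠ ε in 𝓝[>] (0:ℝ), ENNReal.ofReal M ≤
      volume (rayNbhd ε (spiralArc f (Set.Ici φ₁))) / ENNReal.ofReal (ε ^ (2 - 2/(1+α))) := by
  obtain ⟨hα0, hα1⟩ := hα
  have h1α : 0 < 1 + α := by linarith
  have hl' : (0 : ℝ) < l := by positivity
  have hlp : 0 < (l : ℝ) / (1 + α) := div_pos hl' h1α
  have hexp : (2.7 : ℝ) < Real.exp 1 := by have := Real.exp_one_gt_d9; linarith
  have hπ := Real.pi_pos
  have hπ2 := Real.pi_lt_d2
  set q := α / (1 + α) with hq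
  have h2q : 2 - 2 / (1 + α) = q * 2 := by rw [hq]; field_simp; ring
  rw [h2q]
  set G : ℝ → ℝ := fun x => x ^ (-(1 + α)) * Real.log x ^ l with hG
  have hGe : ∀ x, ahi * x ^ (-α-1) * Real.log x ^ l = ahi * G x := by
    intro x
    have e : -α - 1 = -(1 + α) := by ring
    simp only [hG]; rw [e]; ring
  have hlogpos : ∀ x, φ₁ ≤ x → 1 < Real.log x := by
    intro x hx
    rw [Real.lt_log_iff_exp_lt (by linarith)]; linarith
  have hGpos : ∀ x, φ₁ ≤ x → 0 < G x := by
    intro x hx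
    have := hlogpos x hx
    have : 0 < x := by linarith
    simp only [hG]; positivity
  have hGtend : Tendsto G atTop (𝓝 0) := powlog_tendsto (1 + α) h1α l hl
  have htend : Tendsto (fun x : ℝ => ((mlo * 4 ^ (-α)) ^ 2 * Real.pi) *
      (Real.log x ^ ((l : ℝ) / (1 + α))) ^ 2) atTop atTop := by
    apply Tendsto.const_mul_atTop (by positivity)
    exact (tendsto_pow_atTop (by norm_num)).comp
      ((tendsto_rpow_atTop hlp).comp Real.tendsto_log_atTop)
  obtain ⟨B, hBM, hBφ, hBA⟩ := ((htend.eventually_ge_atTop (M * (2 * ahi) ^ (q * 2))).and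
    ((eventually_ge_atTop φ₁).and (eventually_ge_atTop (Real.exp (((1 + α) / l)⁻¹))))).exists
  have hB0 : 0 < 2 * ahi * G B := by have := hGpos B hBφ; positivity
  filter_upwards [Ioo_mem_nhdsGT hB0] with ε hε
  obtain ⟨hε0, hε1⟩ := hε
  -- choose Φ
  obtain ⟨Φ, hΦB, hΦε⟩ : ∃ Φ, B ≤ Φ ∧ 2 * ahi * G Φ = ε := by
    obtain ⟨X, hX, hXB⟩ := (((hGtend.const_mul (2 * ahi)).eventually
      (gt_mem_nhds (show 2 * ahi * 0 < ε by simpa using hε0))).and (eventually_ge_atTop B)).exists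
    have hc : ContinuousOn (fun x => 2 * ahi * G x) (Set.Icc B X) := by
      intro x hx
      have hx0 : x ≠ 0 := by have := hx.1; intro h; linarith
      apply ContinuousAt.continuousWithinAt
      apply ContinuousAt.mul continuousAt_const
      apply ContinuousAt.mul
      · exact Real.continuousAt_rpow_const _ _ (Or.inl hx0)
      · exact (Real.continuousAt_log hx0).pow l
    obtain ⟨Φ, h1, h2⟩ := intermediate_value_Icc' hXB hc ⟨le_of_lt hX, hε1.le⟩
    exact ⟨Φ, h1.1, h2⟩
  have hΦφ : φ₁ ≤ Φ := hBφ.trans hΦB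
  have hΦ0 : 0 < Φ := by linarith
  have hL := hlogpos Φ hΦφ
  have hL0 : 0 < Real.log Φ := by linarith
  have hGΦ := hGpos Φ hΦφ
  set R := mlo * 4 ^ (-α) * (Φ ^ (-α) * Real.log Φ ^ l) with hRdef
  have hsub := nucleus_subset φ₁ Φ ε R f hΦφ ?_ ?_ hf_pos ?_
  rotate_left
  · intro θ hθ r hr
    have ht : Tendsto (fun k : ℕ => θ + 2 * Real.pi * (k : ℝ)) atTop atTop :=
      tendsto_atTop_add_const_left _ _
        (tendsto_natCast_atTop_atTop.const_mul_atTop (by positivity))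
    have h2 := ((powlog_tendsto α hα0 l hl).const_mul mhi).comp ht
    rw [mul_zero] at h2
    obtain ⟨k, hk⟩ := (h2.eventually (gt_mem_nhds hr)).exists
    refine ⟨k, lt_of_le_of_lt (hf_bd _ ?_).2 ?_⟩
    · have : 0 ≤ 2 * Real.pi * (k : ℝ) := by positivity
      linarith
    · simpa [mul_assoc] using hk
  · intro θ hθ
    have h1 := hf_diff_bd θ (hΦφ.trans hθ)
    rw [hGe] at h1
    have h2 : G θ ≤ G Φ := powlog_antitone (1 + α) h1α l hl Φ θ (hBA.trans hΦB) hθ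
    nlinarith
  · intro θ h1 h2
    refine le_trans ?_ (hf_bd θ (hΦφ.trans h1)).1
    have hθ0 : 0 < θ := by linarith
    have e1 : (4 * Φ) ^ (-α) ≤ θ ^ (-α) :=
      Real.rpow_le_rpow_of_nonpos hθ0 (by linarith) (by linarith)
    rw [Real.mul_rpow (by norm_num) hΦ0.le] at e1
    have e2 : Real.log Φ ^ l ≤ Real.log θ ^ l :=
      pow_le_pow_left₀ hL0.le (Real.log_le_log hΦ0 h1) l
    calc R = mlo * ((4 ^ (-α) * Φ ^ (-α)) * Real.log Φ ^ l) := by rw [hRdef]; ring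
      _ ≤ mlo * (θ ^ (-α) * Real.log θ ^ l) := by
        apply mul_le_mul_of_nonneg_left _ hmlo.le
        apply mul_le_mul e1 e2 (by positivity) (by positivity)
      _ = _ := by ring
  have key : Φ ^ (-α) * Real.log Φ ^ l = G Φ ^ q * Real.log Φ ^ ((l : ℝ) / (1 + α)) := by
    simp only [hG]
    rw [Real.mul_rpow (by positivity) (by positivity), ← Real.rpow_mul hΦ0.le,
      ← Real.rpow_natCast (Real.log Φ), ← Real.rpow_mul hL0.le, mul_assoc, ← Real.rpow_add hL0]
    congr 2
    · rw [hq]; field_simp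
    · rw [hq]; field_simp; ring
  have hR0 : 0 ≤ R := by positivity
  have hfin : M * ε ^ (q * 2) ≤ R ^ 2 * Real.pi := by
    have hg : 0 ≤ (G Φ ^ q) ^ 2 := by positivity
    have hmono : Real.log B ^ ((l : ℝ) / (1 + α)) ≤ Real.log Φ ^ ((l : ℝ) / (1 + α)) := by
      apply Real.rpow_le_rpow _ (Real.log_le_log (by linarith) hΦB) hlp.le
      have := hlogpos B hBφ; linarith
    have hLB : 0 ≤ Real.log B ^ ((l : ℝ) / (1 + α)) := by
      apply Real.rpow_nonneg; have := hlogpos B hBφ; linarith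
    have e2 : (G Φ) ^ (q * 2) = (G Φ ^ q) ^ 2 := by
      rw [Real.rpow_mul hGΦ.le]; norm_cast
    rw [← hΦε, Real.mul_rpow (by positivity) hGΦ.le, hRdef, key, e2]
    calc M * ((2 * ahi) ^ (q * 2) * (G Φ ^ q) ^ 2)
        = (M * (2 * ahi) ^ (q * 2)) * (G Φ ^ q) ^ 2 := by ring
      _ ≤ ((mlo * 4 ^ (-α)) ^ 2 * Real.pi * (Real.log B ^ ((l : ℝ) / (1 + α))) ^ 2) * (G Φ ^ q) ^ 2 :=
          mul_le_mul_of_nonneg_right hBM hg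
      _ ≤ ((mlo * 4 ^ (-α)) ^ 2 * Real.pi * (Real.log Φ ^ ((l : ℝ) / (1 + α))) ^ 2) * (G Φ ^ q) ^ 2 := by
          gcongr
      _ = _ := by ring
  have hE : 0 < ε ^ (q * 2) := Real.rpow_pos_of_pos hε0 _
  rw [ENNReal.le_div_iff_mul_le (Or.inl (by simpa using hE)) (Or.inl ENNReal.ofReal_ne_top),
    ← ENNReal.ofReal_mul hM]
  refine le_trans (ENNReal.ofReal_le_ofReal hfin) (le_trans (le_of_eq ?_) (measure_mono hsub))
  rw [volume_nucleus, ENNReal.ofReal_mul (by positivity), ENNReal.ofReal_pow hR0]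

lemma upper_bound
    (φ₁ α : ℝ) (l : ℕ) (hl : 1 ≤ l) (f : ℝ → ℝ)
    (hφ₁ : Real.exp 1 < φ₁)
    (hα : α ∈ Set.Ioo (0:ℝ) 1)
    (hf_meas : Measurable f)
    (hf_pos : ∀ φ ≥ φ₁, 0 < f φ)
    (mhi : ℝ) (hmhi : 0 < mhi)
    (hf_bd : ∀ φ ≥ φ₁, f φ ≤ mhi * φ ^ (-α) * Real.log φ ^ l)
    (s : ℝ) (hs : 2 / (1 + α) < s) :
    Tendsto (fun ε : ℝ => volume (rayNbhd ε (spiralArc f (Set.Ici φ₁))) /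
      ENNReal.ofReal (ε ^ (2 - s))) (𝓝[>] (0:ℝ)) (𝓝 0) := by
  obtain ⟨hα0, hα1⟩ := hα
  have h1α : 0 < 1 + α := by linarith
  have hl' : (0 : ℝ) < l := by positivity
  have hφ0 : 0 < φ₁ := (Real.exp_pos 1).trans hφ₁
  have hφ1 : 1 < φ₁ := lt_of_le_of_lt (Real.one_le_exp (by norm_num)) hφ₁
  have hmax : max 0 ((2 - s) * (1 + α) / 2) < α := by
    rw [div_lt_iff₀ h1α] at hs
    apply max_lt hα0
    nlinarith
  obtain ⟨β, hβ, hβα⟩ := exists_between hmax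
  have hβ0 : 0 < β := lt_of_le_of_lt (le_max_left _ _) hβ
  have hβs : (2 - s) * (1 + α) / 2 < β := lt_of_le_of_lt (le_max_right _ _) hβ
  have hβ1 : 0 < 1 - β := by linarith
  set γ := 2 * β / (1 + α) - (2 - s) with hγ
  have hγ0 : 0 < γ := by
    rw [hγ, sub_pos, lt_div_iff₀ h1α]; linarith
  set D := mhi * (1 / ((α - β) / l)) ^ l with hD
  have hδ : 0 < (α - β) / l := div_pos (by linarith) hl'
  have hD0 : 0 < D := by positivity
  have hfD : ∀ φ ≥ φ₁, f φ ≤ D * φ ^ (-β) := by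
    intro φ hφ
    have hp : 0 < φ := by linarith
    refine (hf_bd φ hφ).trans ?_
    have h1 : Real.log φ ^ l ≤ (φ ^ ((α - β) / l) / ((α - β) / l)) ^ l :=
      pow_le_pow_left₀ (Real.log_nonneg (by linarith)) (Real.log_le_rpow_div hp.le hδ) l
    have h2 : (φ ^ ((α - β) / l)) ^ l = φ ^ (α - β) := by
      rw [← Real.rpow_natCast, ← Real.rpow_mul hp.le, div_mul_cancel₀ _ hl'.ne']
    have h3 : φ ^ (-β) = φ ^ (-α) * φ ^ (α - β) := by
      rw [← Real.rpow_add hp]; congr 1; ring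
    calc mhi * φ ^ (-α) * Real.log φ ^ l
        ≤ mhi * φ ^ (-α) * (φ ^ ((α - β) / l) / ((α - β) / l)) ^ l := by gcongr
      _ = D * φ ^ (-β) := by
        rw [div_pow, h2, h3, hD, one_div, inv_pow]; ring
  set C := D + 1 with hC
  set K := C ^ 2 * Real.pi + 2 * C / (1 - β) with hK
  have hC0 : 0 < C := by positivity
  have hK0 : 0 < K := by have := Real.pi_pos; positivity
  have hlim : Tendsto (fun ε : ℝ => ENNReal.ofReal (K * ε ^ γ)) (𝓝[>] (0:ℝ)) (𝓝 0) := by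
    have h1 : Tendsto (fun ε : ℝ => K * ε ^ γ) (𝓝 (0:ℝ)) (𝓝 (K * 0 ^ γ)) :=
      ((Real.continuousAt_rpow_const 0 γ (Or.inr hγ0.le)).tendsto).const_mul K
    rw [Real.zero_rpow hγ0.ne', mul_zero] at h1
    have := ENNReal.tendsto_ofReal (h1.mono_left nhdsWithin_le_nhds : Tendsto _ (𝓝[>] (0:ℝ)) _)
    simpa using this
  refine tendsto_of_tendsto_of_tendsto_of_le_of_le' tendsto_const_nhds hlim
    (Eventually.of_forall fun _ => zero_le) ?_
  filter_upwards [Ioo_mem_nhdsGT (zero_lt_one (α := ℝ))] with ε hε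
  obtain ⟨hε0, hε1⟩ := hε
  set Φ := ε ^ (-1 / (1 + α)) with hΦ
  have hΦ0 : 0 < Φ := Real.rpow_pos_of_pos hε0 _
  have hεΦ : ε ≤ Φ ^ (-β) := by
    rw [hΦ, ← Real.rpow_mul hε0.le]
    conv_lhs => rw [← Real.rpow_one ε]
    apply Real.rpow_le_rpow_of_exponent_ge hε0 hε1.le
    rw [div_mul_eq_mul_div, div_le_one h1α]; linarith
  have hsub := rayNbhd_subset φ₁ Φ ε (C * Φ ^ (-β)) f hf_pos (by
    intro θ hθ h
    have h1 := hfD θ hθ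
    have h2 : θ ^ (-β) ≤ Φ ^ (-β) := Real.rpow_le_rpow_of_nonpos hΦ0 h (by linarith)
    rw [hC]; nlinarith)
  have htube := tube_bound φ₁ Φ ε C β f hf_meas hε0 hφ0 (by linarith) hC0.le
    (fun θ hθ => hf_pos θ hθ.1) (by
      intro θ hθ
      have h1 := hfD θ hθ.1
      have h2 : Φ ^ (-β) ≤ θ ^ (-β) :=
        Real.rpow_le_rpow_of_nonpos (hφ0.trans_le hθ.1) hθ.2 (by linarith)
      rw [hC]; nlinarith)
  have hvol := (measure_mono hsub).trans ((measure_union_le _ _).trans (add_le_add le_rfl htube))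
  rw [EuclideanSpace.volume_ball_fin_two] at hvol
  have hE : 0 < ε ^ (2 - s) := Real.rpow_pos_of_pos hε0 _
  rw [ENNReal.div_le_iff (by simpa using hE) ENNReal.ofReal_ne_top,
    ← ENNReal.ofReal_mul (by positivity)]
  refine hvol.trans ?_
  have hπ := Real.pi_pos
  rw [← ENNReal.ofReal_pow (by positivity), ← ENNReal.ofReal_mul (by positivity),
    ← ENNReal.ofReal_add (by positivity) (by positivity)]
  apply ENNReal.ofReal_le_ofReal
  have e1 : (Φ ^ (-β)) ^ 2 = ε ^ (2 * β / (1 + α)) := by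
    rw [hΦ, ← Real.rpow_mul hε0.le, ← Real.rpow_natCast, ← Real.rpow_mul hε0.le]
    congr 1; push_cast; field_simp
  have e2 : ε * Φ ^ (1 - β) ≤ ε ^ (2 * β / (1 + α)) := by
    rw [hΦ, ← Real.rpow_mul hε0.le]
    nth_rewrite 1 [← Real.rpow_one ε]
    rw [← Real.rpow_add hε0]
    apply Real.rpow_le_rpow_of_exponent_ge hε0 hε1.le
    rw [div_mul_eq_mul_div, ← sub_nonneg]
    have : 1 + -1 * (1 - β) / (1 + α) - 2 * β / (1 + α) = (α - β) / (1 + α) := by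
      field_simp; ring
    rw [this]; exact div_nonneg (by linarith) h1α.le
  have e3 : K * ε ^ γ * ε ^ (2 - s) = K * ε ^ (2 * β / (1 + α)) := by
    rw [mul_assoc, ← Real.rpow_add hε0, hγ]; congr 2; ring
  rw [e3, mul_pow, e1, hK]
  have e4 : 2 * ε * C * (Φ ^ (1 - β) / (1 - β)) = 2 * C / (1 - β) * (ε * Φ ^ (1 - β)) := by ring
  rw [e4]
  have : 2 * C / (1 - β) * (ε * Φ ^ (1 - β)) ≤ 2 * C / (1 - β) * ε ^ (2 * β / (1 + α)) := by
    gcongr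
  linarith

/-- **Theorem (modified Theorem 1 from [zuzu])**: for a measurable, radially decreasing
`f` with two-sided power-log bounds on `f(φ)` and on `f(φ) - f(φ+2π)`, the spiral `r = f(φ)`
has radial box dimension `d = 2/(1+α)` and `M^{*d}(Γ, rad) = +∞`. -/
theorem radial_dimension_log_spiral
    (φ₁ α : ℝ) (l : ℕ) (hl : 1 ≤ l) (f : ℝ → ℝ)
    (hφ₁ : Real.exp 1 < φ₁)
    (hα : α ∈ Set.Ioo (0:ℝ) 1)
    (hf_meas : Measurable f)
    (hf_pos : ∀ φ ≥ φ₁, 0 < f φ)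
    -- f is radially decreasing
    (hf_rad : ∀ φ ≥ φ₁, StrictAnti (fun k : ℕ => f (φ + 2 * Real.pi * k)))
    (mlo mhi alo ahi : ℝ) (hmlo : 0 < mlo) (hmhi : 0 < mhi) (halo : 0 < alo) (hahi : 0 < ahi)
    (hf_bd : ∀ φ ≥ φ₁,
      mlo * φ ^ (-α) * Real.log φ ^ l ≤ f φ ∧ f φ ≤ mhi * φ ^ (-α) * Real.log φ ^ l)
    (hf_diff_bd : ∀ φ ≥ φ₁,
      alo * φ ^ (-α-1) * Real.log φ ^ l ≤ f φ - f (φ + 2 * Real.pi) ∧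
      f φ - f (φ + 2 * Real.pi) ≤ ahi * φ ^ (-α-1) * Real.log φ ^ l) :
    radDimBEq (spiralArc f (Set.Ici φ₁)) (2/(1+α)) ∧
    radUpperMink (2/(1+α)) (spiralArc f (Set.Ici φ₁)) = ⊤ := by
  have hα0 := hα.1
  have h1α : 0 < 1 + α := by linarith
  set A := spiralArc f (Set.Ici φ₁) with hA
  set d := 2 / (1 + α) with hd
  have hd0 : 0 < d := by positivity
  have hlow : Tendsto (fun ε : ℝ => volume (rayNbhd ε A) / ENNReal.ofReal (ε ^ (2 - d)))
      (𝓝[>] (0:ℝ)) (𝓝 ⊤) := by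
    rw [ENNReal.tendsto_nhds_top_iff_nat]
    intro n
    have h := lower_bound φ₁ α l hl f hφ₁ hα hf_pos mlo mhi ahi hmlo hahi hf_bd
      (fun φ hφ => (hf_diff_bd φ hφ).2) (n + 1) (by positivity)
    filter_upwards [h] with ε hε
    refine lt_of_lt_of_le ?_ hε
    rw [← ENNReal.ofReal_natCast, ENNReal.ofReal_lt_ofReal_iff (by positivity)]
    linarith
  have hup : ∀ s, d < s → Tendsto (fun ε : ℝ => volume (rayNbhd ε A) / ENNReal.ofReal (ε ^ (2 - s)))
      (𝓝[>] (0:ℝ)) (𝓝 0) := fun s hs =>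
    upper_bound φ₁ α l hl f hφ₁ hα hf_meas hf_pos mhi hmhi (fun φ hφ => (hf_bd φ hφ).2) s hs
  have hlow2 : ∀ s ≤ d, Tendsto (fun ε : ℝ => volume (rayNbhd ε A) / ENNReal.ofReal (ε ^ (2 - s)))
      (𝓝[>] (0:ℝ)) (𝓝 ⊤) := by
    intro s hs
    refine tendsto_of_tendsto_of_tendsto_of_le_of_le' hlow tendsto_const_nhds ?_
      (Eventually.of_forall fun _ => le_top)
    filter_upwards [Ioo_mem_nhdsGT (zero_lt_one (α := ℝ))] with ε hε
    apply ENNReal.div_le_div_left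
    apply ENNReal.ofReal_le_ofReal
    exact Real.rpow_le_rpow_of_exponent_ge hε.1 hε.2.le (by linarith)
  have hset : ∀ P : ℝ → ℝ≥0∞, (∀ s ≤ d, P s = ⊤) → (∀ s, d < s → P s = 0) →
      sInf {s : ℝ | 0 ≤ s ∧ P s = 0} = d := by
    intro P h1 h2
    have : {s : ℝ | 0 ≤ s ∧ P s = 0} = Set.Ioi d := by
      ext s
      constructor
      · rintro ⟨-, h⟩
        by_contra hc
        rw [h1 s (not_lt.mp hc)] at h
        exact ENNReal.top_ne_zero h
      · intro h
        exact ⟨hd0.le.trans (le_of_lt h), h2 s h⟩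
    rw [this, csInf_Ioi]
  refine ⟨⟨hset _ (fun s hs => (hlow2 s hs).liminf_eq) (fun s hs => (hup s hs).liminf_eq),
    hset _ (fun s hs => (hlow2 s hs).limsup_eq) (fun s hs => (hup s hs).limsup_eq)⟩, hlow.limsup_eq⟩
end
end

section
/- Let Γ be a spiral defined by r = f(φ), where f : [φ₁,∞) → (0,∞) is decreasing and f(φ) → 0 as φ → ∞. Define φ₂(ε) = inf{φ ≥ φ₁ : for all ψ ≥ φ, f(ψ) − f(ψ+2π) ≤ 2ε}. Suppose there exists ε₀ > 0 such that the functional inequality f(φ + ε/f(φ) + ε/(f(φ)−ε)) > f(φ) − ε holds for all ε ∈ (0,ε₀) and all φ ∈ (φ₁, φ₂(ε)). Assume also that there exist positive constants C̲, C̄, a constant q < 1, and l ∈ ℕ such that C̲ ε^q ≤ f(φ₂(ε)) ≤ C̄ ε^{1−d/2} (log(1/ε))^l, where d is the upper radial box dimension of Γ. Then the upper box dimension of Γ equals the upper radial box dimension of Γ. -/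
open MeasureTheory Filter Metric Set Topology ENNReal

noncomputable section

theorem geom_aux (r φ ε : ℝ) (hε : 0 < ε) (hr : 2 * ε ≤ r) (y : E2)
    (hy : dist y (pt (r * Real.cos φ) (r * Real.sin φ)) < ε) :
    ∃ θ ρ : ℝ, 0 < ρ ∧ |ρ - r| < ε ∧ |θ - φ| ≤ 2 * ε / r ∧
      y = pt (ρ * Real.cos θ) (ρ * Real.sin θ) := by
  have hrpos : 0 < r := by linarith
  have hd : (y 0 - r * Real.cos φ) ^ 2 + (y 1 - r * Real.sin φ) ^ 2 < ε ^ 2 := by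
    rw [EuclideanSpace.dist_eq, Real.sqrt_lt' hε] at hy
    simpa [pt, Fin.sum_univ_two, Real.dist_eq, sq_abs] using hy
  have hcs := Real.sin_sq_add_cos_sq φ
  set w : ℂ := ⟨y 0 * Real.cos φ + y 1 * Real.sin φ, - y 0 * Real.sin φ + y 1 * Real.cos φ⟩ with hw
  set ρ := ‖w‖ with hρ
  set α := w.arg with hα
  have h1 : ρ * Real.cos α = y 0 * Real.cos φ + y 1 * Real.sin φ := Complex.norm_mul_cos_arg w
  have h2 : ρ * Real.sin α = - y 0 * Real.sin φ + y 1 * Real.cos φ := Complex.norm_mul_sin_arg w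
  have hcsα := Real.sin_sq_add_cos_sq α
  have hd2 : (ρ * Real.cos α - r) ^ 2 + (ρ * Real.sin α) ^ 2 < ε ^ 2 := by
    rw [h1, h2]
    refine lt_of_eq_of_lt ?_ hd
    linear_combination (y 0 ^ 2 + y 1 ^ 2 - r ^ 2) * hcs
  have hd3 : (ρ - r * Real.cos α) ^ 2 + (r * Real.sin α) ^ 2 < ε ^ 2 := by
    refine lt_of_eq_of_lt ?_ hd2
    linear_combination (r ^ 2 - ρ ^ 2) * hcsα
  have hre : |ρ * Real.cos α - r| < ε := by
    apply abs_lt_of_sq_lt_sq _ hε.le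
    nlinarith [sq_nonneg (ρ * Real.sin α)]
  have hrepos : 0 < ρ * Real.cos α := by
    have := (abs_lt.1 hre).1
    linarith
  have hρ0 : 0 ≤ ρ := norm_nonneg w
  have hρpos : 0 < ρ := by
    rcases hρ0.eq_or_lt with h | h
    · rw [← h] at hrepos; simp at hrepos
    · exact h
  have hα2 : |α| ≤ Real.pi / 2 := by
    rw [hα, Complex.abs_arg_le_pi_div_two_iff]
    rw [h1] at hrepos
    exact hrepos.le
  have hsin : r * |Real.sin α| < ε := by
    have : |r * Real.sin α| < ε := by
      apply abs_lt_of_sq_lt_sq _ hε.le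
      nlinarith [sq_nonneg (ρ - r * Real.cos α)]
    rwa [abs_mul, abs_of_pos hrpos] at this
  have hdr : |ρ - r| < ε := by
    apply abs_lt_of_sq_lt_sq _ hε.le
    have hc1 := Real.cos_le_one α
    refine lt_of_le_of_lt ?_ hd2
    have e : (ρ * Real.cos α - r) ^ 2 + (ρ * Real.sin α) ^ 2
        = (ρ - r) ^ 2 + 2 * (ρ * r * (1 - Real.cos α)) := by
      linear_combination ρ ^ 2 * hcsα
    have := mul_nonneg (mul_nonneg hρ0 hrpos.le) (sub_nonneg.2 hc1)
    linarith
  refine ⟨φ + α, ρ, hρpos, hdr, ?_, ?_⟩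
  · have h3 := Real.mul_abs_le_abs_sin hα2
    have hpi : (1:ℝ) / 2 ≤ 2 / Real.pi := by
      rw [div_le_div_iff₀ (by norm_num) Real.pi_pos]
      linarith [Real.pi_le_four]
    have h4 : 1 / 2 * |α| ≤ |Real.sin α| :=
      le_trans (mul_le_mul_of_nonneg_right hpi (abs_nonneg _)) h3
    rw [add_sub_cancel_left, le_div_iff₀ hrpos]
    nlinarith
  · ext i
    fin_cases i
    · simp only [pt, Real.cos_add]
      simp
      linear_combination (-y 0) * hcs - Real.cos φ * h1 + Real.sin φ * h2
    · simp only [pt, Real.sin_add]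
      simp
      linear_combination (-y 1) * hcs - Real.sin φ * h1 - Real.cos φ * h2

theorem iter_aux (f : ℝ → ℝ) (φ₁ φ₂ ε : ℝ) (hε : 0 < ε)
    (hf_dec : StrictAntiOn f (Set.Ici φ₁))
    (hbig : ∀ φ ∈ Set.Ioo φ₁ φ₂, 2 * ε ≤ f φ)
    (hfi : ∀ φ ∈ Set.Ioo φ₁ φ₂, f φ - ε < f (φ + ε / f φ + ε / (f φ - ε)))
    (θ φ : ℝ) (hθ : φ₁ < θ) (hθφ : θ ≤ φ) (hφ : φ < φ₂) :
    f θ * (1 - (φ - θ) / 2) ≤ f φ + ε := by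
  have hfθ : 2 * ε ≤ f θ := hbig θ ⟨hθ, by linarith⟩
  have hfθ0 : 0 < f θ := by linarith
  have step : ∀ k : ℕ, (∀ j : ℕ, j < k → θ + 2 * j * ε / f θ < φ) →
      f θ - k * ε ≤ f (θ + 2 * k * ε / f θ) := by
    intro k
    induction k with
    | zero => intro _; simp
    | succ k ih =>
      intro h
      have h1 := ih (fun j hj => h j (by omega))
      have h2 := h k (by omega)
      set a := θ + 2 * k * ε / f θ with ha
      have hk : 0 ≤ 2 * k * ε / f θ := by positivity
      have haI : a ∈ Set.Ioo φ₁ φ₂ := ⟨by linarith, by linarith⟩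
      have hfa := hbig a haI
      have h3 := hfi a haI
      have hle : f a ≤ f θ := hf_dec.antitoneOn hθ.le haI.1.le (by linarith)
      have e1 : ε / f θ ≤ ε / f a := div_le_div_of_nonneg_left hε.le (by linarith) hle
      have e2 : ε / f θ ≤ ε / (f a - ε) :=
        div_le_div_of_nonneg_left hε.le (by linarith) (by linarith)
      have e3 : θ + 2 * ((k + 1 : ℕ) : ℝ) * ε / f θ = a + ε / f θ + ε / f θ := by
        rw [ha]; push_cast; ring
      have e0 : 0 ≤ ε / f θ := by positivity
      have h4 : f (a + ε / f a + ε / (f a - ε)) ≤ f (a + ε / f θ + ε / f θ) := by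
        apply hf_dec.antitoneOn
        · simp only [Set.mem_Ici]; linarith [haI.1]
        · simp only [Set.mem_Ici]; linarith [haI.1]
        · linarith
      rw [e3]
      push_cast
      linarith
  set k := ⌈(φ - θ) * f θ / (2 * ε)⌉₊ with hk
  have hx : 0 ≤ (φ - θ) * f θ / (2 * ε) := by
    have : 0 ≤ φ - θ := by linarith
    positivity
  have hk1 : (φ - θ) * f θ / (2 * ε) ≤ k := Nat.le_ceil _
  have hk2 : (k : ℝ) < (φ - θ) * f θ / (2 * ε) + 1 := Nat.ceil_lt_add_one hx
  have h1 := step k (by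
    intro j hj
    have := Nat.lt_ceil.1 hj
    rw [lt_div_iff₀ (by positivity)] at this
    have : 2 * j * ε / f θ < φ - θ := by
      rw [div_lt_iff₀ hfθ0]; linarith
    linarith)
  have h2 : φ ≤ θ + 2 * k * ε / f θ := by
    rw [div_le_iff₀ (by positivity)] at hk1
    have : φ - θ ≤ 2 * k * ε / f θ := by
      rw [le_div_iff₀ hfθ0]; linarith
    linarith
  have h3 : f (θ + 2 * k * ε / f θ) ≤ f φ :=
    hf_dec.antitoneOn (by simp only [Set.mem_Ici]; linarith)
      (by simp only [Set.mem_Ici]; linarith) h2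
  have h4 : k * ε ≤ (φ - θ) * f θ / 2 + ε := by
    have := mul_le_mul_of_nonneg_right hk2.le hε.le
    have e : ((φ - θ) * f θ / (2 * ε) + 1) * ε = (φ - θ) * f θ / 2 + ε := by
      field_simp
    linarith
  linarith

theorem dist_pt_sq (a b c d : ℝ) : dist (pt a b) (pt c d) = Real.sqrt ((a - c) ^ 2 + (b - d) ^ 2) := by
  rw [EuclideanSpace.dist_eq]
  simp [pt, Fin.sum_univ_two, Real.dist_eq, sq_abs]

theorem dist_pt_same (a b θ : ℝ) :
    dist (pt (a * Real.cos θ) (a * Real.sin θ)) (pt (b * Real.cos θ) (b * Real.sin θ)) = |a - b| := by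
  rw [dist_pt_sq, ← Real.sqrt_sq_eq_abs]
  congr 1
  linear_combination (a - b) ^ 2 * Real.sin_sq_add_cos_sq θ

theorem dist_pt_le (a b : ℝ) (ha : 0 ≤ a) (θ φ : ℝ) :
    dist (pt (a * Real.cos θ) (a * Real.sin θ)) (pt (b * Real.cos φ) (b * Real.sin φ))
      ≤ |a - b| + 2 * a * |θ - φ| := by
  refine (dist_triangle _ (pt (a * Real.cos φ) (a * Real.sin φ)) _).trans ?_
  rw [dist_pt_same, add_comm]
  gcongr
  rw [dist_pt_sq]
  apply Real.sqrt_le_iff.2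
  refine ⟨by positivity, ?_⟩
  have h1 : |Real.cos θ - Real.cos φ| ≤ |θ - φ| := Real.abs_cos_sub_cos_le θ φ
  have h2 : |Real.sin θ - Real.sin φ| ≤ |θ - φ| := Real.abs_sin_sub_sin_le θ φ
  have h1' := sq_le_sq.2 (h1.trans (le_abs_self _))
  have h2' := sq_le_sq.2 (h2.trans (le_abs_self _))
  have := mul_le_mul_of_nonneg_left (add_le_add h1' h2') (sq_nonneg a)
  nlinarith [mul_nonneg (sq_nonneg a) (sq_nonneg |θ - φ|)]

theorem cover_aux (φ₁ : ℝ) (f : ℝ → ℝ)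
    (hf_pos : ∀ φ ≥ φ₁, 0 < f φ)
    (hf_dec : StrictAntiOn f (Set.Ici φ₁)) (φ₂ ε : ℝ) (hφ : φ₁ ≤ φ₂) (hε : 0 < ε)
    (hbig2 : 2 * ε ≤ f φ₂)
    (hfi : ∀ φ ∈ Set.Ioo φ₁ φ₂, f φ - ε < f (φ + ε / f φ + ε / (f φ - ε))) :
    ∃ z0 z1 : E2, Metric.thickening ε (spiralArc f (Set.Ici φ₁)) ⊆
      rayNbhd (5 * ε) (spiralArc f (Set.Ici φ₁)) ∪ (ball (0 : E2) (2 * f φ₂) ∪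
        (ball z1 ε ∪ ball z0 ((2 + 5 * f φ₁ / f (φ₁ + 1)) * ε))) := by
  have hanti := hf_dec.antitoneOn
  have hbig : ∀ φ ∈ Set.Ioo φ₁ φ₂, 2 * ε ≤ f φ := by
    intro φ h
    exact hbig2.trans (hanti h.1.le hφ h.2.le)
  have hit := iter_aux f φ₁ φ₂ ε hε hf_dec hbig hfi
  set c := f (φ₁ + 1) with hc
  set M := f φ₁ with hM
  have hc0 : 0 < c := hf_pos _ (by linarith)
  have hM0 : 0 < M := hf_pos _ le_rfl
  have hP : ∃ z0 : E2, ∀ φ ∈ Set.Ioo φ₁ φ₂, φ ≤ φ₁ + 2 * ε / c →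
      dist (pt (f φ * Real.cos φ) (f φ * Real.sin φ)) z0 ≤ (1 + 5 * M / c) * ε := by
    by_cases h : ∃ φ0 ∈ Set.Ioo φ₁ φ₂, φ0 ≤ φ₁ + 2 * ε / c
    · obtain ⟨φ0, h0, h0'⟩ := h
      refine ⟨pt (f φ0 * Real.cos φ0) (f φ0 * Real.sin φ0), fun φ h1 h1' => ?_⟩
      have hfφ : 0 < f φ := hf_pos _ h1.1.le
      refine (dist_pt_le _ _ hfφ.le _ _).trans ?_
      have key : ∀ a b, a ∈ Set.Ioo φ₁ φ₂ → b ∈ Set.Ioo φ₁ φ₂ → a ≤ b → b ≤ φ₁ + 2 * ε / c →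
          f a - f b ≤ ε + M * (ε / c) ∧ 0 ≤ f a - f b := by
        intro a b ha hb hab hbc
        have h2 := hit a b ha.1 hab hb.2
        have h3 : f b ≤ f a := hanti ha.1.le hb.1.le hab
        have h4 : f a ≤ M := hanti Set.self_mem_Ici ha.1.le ha.1.le
        have h5 : 0 < f a := hf_pos _ ha.1.le
        have h6 : (b - a) / 2 ≤ ε / c := by
          have : 2 * ε / c = 2 * (ε / c) := by ring
          linarith [ha.1]
        have h7 : f a * ((b - a) / 2) ≤ M * (ε / c) :=
          mul_le_mul h4 h6 (by linarith) hM0.le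
        constructor <;> nlinarith
      have hA : |f φ - f φ0| ≤ ε + M * (ε / c) := by
        rcases le_total φ φ0 with h | h
        · have := key φ φ0 h1 h0 h h0'
          rw [abs_of_nonneg this.2]; exact this.1
        · have := key φ0 φ h0 h1 h h1'
          rw [abs_sub_comm, abs_of_nonneg this.2]; exact this.1
      have hB : |φ - φ0| ≤ 2 * (ε / c) := by
        have : 2 * ε / c = 2 * (ε / c) := by ring
        rw [abs_le]; constructor <;> linarith [h0.1, h1.1]
      have hC : f φ ≤ M := hanti Set.self_mem_Ici h1.1.le h1.1.le
      have hD : f φ * |φ - φ0| ≤ M * (2 * (ε / c)) := mul_le_mul hC hB (abs_nonneg _) hM0.le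
      have hE : (1 + 5 * M / c) * ε = ε + 5 * (M * (ε / c)) := by ring
      rw [hE]; linarith
    · push Not at h
      exact ⟨0, fun φ h1 h2 => absurd h2 (not_le.2 (h φ h1))⟩
  obtain ⟨z0, hz0⟩ := hP
  refine ⟨z0, pt (f φ₁ * Real.cos φ₁) (f φ₁ * Real.sin φ₁), ?_⟩
  intro y hy
  rw [Metric.mem_thickening_iff] at hy
  obtain ⟨z, ⟨φ, hφ1, rfl⟩, hyz⟩ := hy
  simp only [Set.mem_Ici] at hφ1
  simp only at hyz
  rcases le_or_gt φ₂ φ with h2 | h2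
  · right; left
    rw [mem_ball]
    have h3 : f φ ≤ f φ₂ := hanti hφ hφ1 h2
    have h4 : dist (pt (f φ * Real.cos φ) (f φ * Real.sin φ)) 0 = f φ := by
      have e : (0 : E2) = pt (0 * Real.cos φ) (0 * Real.sin φ) := by
        ext i; fin_cases i <;> simp [pt]
      rw [e, dist_pt_same, sub_zero, abs_of_pos (hf_pos _ hφ1)]
    linarith [dist_triangle y (pt (f φ * Real.cos φ) (f φ * Real.sin φ)) 0]
  rcases hφ1.eq_or_lt with h1 | h1
  · right; right; left
    rw [mem_ball, h1]; exact hyz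
  have hfφ := hbig φ ⟨h1, h2⟩
  have hfφ0 : 0 < f φ := by linarith
  obtain ⟨θ, ρ, hρ, hρr, hθ, hy⟩ := geom_aux (f φ) φ ε hε hfφ y hyz
  rcases le_or_gt θ φ₁ with h3 | h3
  · right; right; right
    rw [mem_ball]
    have h4 : 2 * ε / f φ ≤ 1 := by rw [div_le_one hfφ0]; exact hfφ
    have h5 := (abs_le.1 hθ).1
    have h6 : c ≤ f φ := hanti hφ1 (by simp only [Set.mem_Ici]; linarith) (by linarith)
    have h7 : 2 * ε / f φ ≤ 2 * ε / c := div_le_div_of_nonneg_left (by linarith) hc0 h6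
    have h8 := hz0 φ ⟨h1, h2⟩ (by linarith)
    have := dist_triangle y (pt (f φ * Real.cos φ) (f φ * Real.sin φ)) z0
    linarith
  · left
    have hfθ : 0 < f θ := hf_pos _ h3.le
    refine ⟨pt (f θ * Real.cos θ) (f θ * Real.sin θ), ⟨θ, h3.le, rfl⟩,
      ⟨f θ / ρ, by positivity, ?_⟩, ?_⟩
    · rw [hy]
      ext i
      fin_cases i
      · simp [pt]; field_simp
      · simp [pt]; field_simp
    · rw [hy, dist_pt_same]
      have hmain : |f θ - f φ| ≤ 4 * ε := by
        rcases le_total θ φ with h | h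
        · have g1 := hit θ φ h3 h h2
          have g2 : f φ ≤ f θ := hanti h3.le hφ1 h
          rw [abs_of_nonneg (by linarith)]
          have g3 : φ - θ ≤ 2 * ε / f φ := by linarith [(abs_le.1 hθ).1]
          rw [le_div_iff₀ hfφ0] at g3
          by_contra hcon
          push Not at hcon
          have g4 : (φ - θ) / 2 ≤ 1 / 2 := by nlinarith
          have g5 : (f φ + 4 * ε) * (1 - (φ - θ) / 2) < f θ * (1 - (φ - θ) / 2) :=
            mul_lt_mul_of_pos_right (by linarith) (by linarith)
          nlinarith
        · have g2 : f θ ≤ f φ := hanti hφ1 h3.le h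
          rw [abs_of_nonpos (by linarith)]
          have g3 : θ - φ ≤ 2 * ε / f φ := by linarith [(abs_le.1 hθ).2]
          have g1 := hfi φ ⟨h1, h2⟩
          have e2 : ε / f φ ≤ ε / (f φ - ε) :=
            div_le_div_of_nonneg_left hε.le (by linarith) (by linarith)
          have e3 : 2 * ε / f φ = ε / f φ + ε / f φ := by ring
          have g4 : f (φ + ε / f φ + ε / (f φ - ε)) ≤ f θ :=
            hanti h3.le (by simp only [Set.mem_Ici]; linarith) (by linarith)
          linarith
      have a1 := abs_lt.1 hρr
      have a2 := abs_le.1 hmain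
      rw [abs_lt]; constructor <;> linarith

theorem vol_ball_aux (x : E2) (r : ℝ) (hr : 0 ≤ r) :
    volume (ball x r) = ENNReal.ofReal (r ^ 2) * volume (ball (0 : E2) 1) := by
  rw [Measure.addHaar_ball volume x hr]
  simp

theorem limsup_zero_iff (g : ℝ → ℝ≥0∞) :
    Filter.limsup g (𝓝[>] (0:ℝ)) = 0 ↔ Tendsto g (𝓝[>] (0:ℝ)) (𝓝 0) := by
  constructor
  · intro h
    exact tendsto_of_le_liminf_of_limsup_le (by simp) (by simp [h])
  · intro h
    exact h.limsup_eq

theorem ray_sub (ε : ℝ) (A : Set E2) : rayNbhd ε A ⊆ Metric.thickening ε A := by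
  rintro y ⟨z, hz, -, hd⟩
  exact Metric.mem_thickening_iff.2 ⟨z, hz, hd⟩

theorem tendsto_mono_aux (g : ℝ → ℝ≥0∞) (s' s : ℝ) (hs : s' ≤ s)
    (h : Tendsto (fun ε : ℝ => g ε / ENNReal.ofReal (ε ^ (2 - s'))) (𝓝[>] (0:ℝ)) (𝓝 0)) :
    Tendsto (fun ε : ℝ => g ε / ENNReal.ofReal (ε ^ (2 - s))) (𝓝[>] (0:ℝ)) (𝓝 0) := by
  refine tendsto_of_tendsto_of_tendsto_of_le_of_le' tendsto_const_nhds h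
    (Eventually.of_forall fun _ => zero_le) ?_
  filter_upwards [Ioo_mem_nhdsGT (zero_lt_one : (0:ℝ) < 1)] with ε hε
  refine ENNReal.div_le_div_left (ENNReal.ofReal_le_ofReal ?_) _
  exact Real.rpow_le_rpow_of_exponent_ge hε.1 hε.2.le (by linarith)

theorem tendsto_log_aux (a : ℝ) (ha : 0 < a) (n : ℕ) (hn : n ≠ 0) :
    Tendsto (fun ε : ℝ => ε ^ a * Real.log (1 / ε) ^ n) (𝓝[>] (0:ℝ)) (𝓝 0) := by
  have hn' : (0:ℝ) < n := by positivity
  have h := ((tendsto_log_mul_rpow_nhdsGT_zero (div_pos ha hn')).neg).pow n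
  rw [neg_zero, zero_pow hn] at h
  refine h.congr' ?_
  filter_upwards [self_mem_nhdsWithin] with ε hε
  have hε : 0 < ε := hε
  rw [one_div, Real.log_inv, ← neg_mul, mul_pow, ← Real.rpow_mul_natCast hε.le,
    div_mul_cancel₀ _ hn'.ne', mul_comm]

theorem tendsto_rpow_aux (a : ℝ) (ha : 0 < a) :
    Tendsto (fun ε : ℝ => ε ^ a) (𝓝[>] (0:ℝ)) (𝓝 0) := by
  have h := (Real.continuous_rpow_const ha.le).tendsto 0
  rw [Real.zero_rpow ha.ne'] at h
  exact h.mono_left nhdsWithin_le_nhds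

theorem tendsto_real_aux (g : ℝ → ℝ) (s : ℝ) (V : ℝ≥0∞) (hV : V ≠ ⊤)
    (h : Tendsto (fun ε : ℝ => g ε / ε ^ (2 - s)) (𝓝[>] (0:ℝ)) (𝓝 0)) :
    Tendsto (fun ε : ℝ => ENNReal.ofReal (g ε) * V / ENNReal.ofReal (ε ^ (2 - s)))
      (𝓝[>] (0:ℝ)) (𝓝 0) := by
  have h1 := ENNReal.Tendsto.mul_const (ENNReal.tendsto_ofReal h) (Or.inr hV)
  rw [ENNReal.ofReal_zero, zero_mul] at h1
  refine h1.congr' ?_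
  filter_upwards [self_mem_nhdsWithin] with ε hε
  have hε : 0 < ε := hε
  rw [ENNReal.ofReal_div_of_pos (Real.rpow_pos_of_pos hε _)]
  simp only [div_eq_mul_inv]
  ring

theorem three_mem_aux (A : Set E2) (R : ℝ) (hA : A ⊆ ball 0 R) : upperMink 3 A = 0 := by
  unfold upperMink
  rw [limsup_zero_iff]
  have h : Tendsto (fun ε : ℝ => ENNReal.ofReal ((|R| + 1) ^ 2) * volume (ball (0 : E2) 1)
      / ENNReal.ofReal (ε ^ (2 - (3:ℝ)))) (𝓝[>] (0:ℝ)) (𝓝 0) := by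
    apply tendsto_real_aux _ _ _ measure_ball_lt_top.ne
    have := (tendsto_rpow_aux 1 one_pos).const_mul ((|R| + 1) ^ 2)
    rw [mul_zero] at this
    refine this.congr' ?_
    filter_upwards [self_mem_nhdsWithin] with ε hε
    have hε : 0 < ε := hε
    rw [div_eq_mul_inv, ← Real.rpow_neg hε.le]
    norm_num
  refine tendsto_of_tendsto_of_tendsto_of_le_of_le' tendsto_const_nhds h
    (Eventually.of_forall fun _ => zero_le) ?_
  filter_upwards [Ioo_mem_nhdsGT (zero_lt_one : (0:ℝ) < 1)] with ε hε
  refine ENNReal.div_le_div_right ?_ _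
  rw [← vol_ball_aux 0 _ (by positivity)]
  apply measure_mono
  intro y hy
  obtain ⟨z, hz, hyz⟩ := Metric.mem_thickening_iff.1 hy
  have h1 := hA hz
  rw [mem_ball] at h1 ⊢
  linarith [dist_triangle y z 0, le_abs_self R, hε.2]

/-- **Theorem (modified Theorem 4 from [zuzu])**: under the functional inequality
`f(φ + ε/f(φ) + ε/(f(φ)-ε)) > f(φ) - ε` on `(φ₁, φ₂(ε))` and two-sided bounds
`C̲ ε^q ≤ f(φ₂(ε)) ≤ C̄ ε^{1-d/2} (log(1/ε))^l`, the upper box dimension of the spiral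
`Γ` equals its upper radial box dimension. -/
theorem upper_box_dimension_eq_radial
    (φ₁ : ℝ) (f : ℝ → ℝ)
    (hf_pos : ∀ φ ≥ φ₁, 0 < f φ)
    (hf_dec : StrictAntiOn f (Set.Ici φ₁))
    (hf_lim : Tendsto f atTop (𝓝 0))
    -- φ₂(ε)
    (φ₂ : ℝ → ℝ)
    (hφ₂ : ∀ ε : ℝ, φ₂ ε = sInf {φ : ℝ | φ₁ ≤ φ ∧ ∀ ψ ≥ φ, f ψ - f (ψ + 2 * Real.pi) ≤ 2 * ε})
    -- the functional inequality
    (ε₀ : ℝ) (hε₀ : 0 < ε₀)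
    (hfi : ∀ ε ∈ Set.Ioo (0:ℝ) ε₀, ∀ φ ∈ Set.Ioo φ₁ (φ₂ ε),
      f φ - ε < f (φ + ε / f φ + ε / (f φ - ε)))
    -- the two-sided bound on f(φ₂(ε))
    (Clo Chi q : ℝ) (l : ℕ) (hClo : 0 < Clo) (hChi : 0 < Chi) (hq : q < 1) (hl : 1 ≤ l)
    (hbound : ∀ ε ∈ Set.Ioo (0:ℝ) ε₀,
      Clo * ε ^ q ≤ f (φ₂ ε) ∧
      f (φ₂ ε) ≤ Chi * ε ^ (1 - radUpperDimB (spiralArc f (Set.Ici φ₁)) / 2) *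
        Real.log (1/ε) ^ l) :
    upperDimB (spiralArc f (Set.Ici φ₁)) = radUpperDimB (spiralArc f (Set.Ici φ₁)) := by
  have hanti := hf_dec.antitoneOn
  set Γ := spiralArc f (Set.Ici φ₁) with hΓ
  set d := radUpperDimB Γ with hd
  have hbdd : Γ ⊆ ball 0 (f φ₁ + 1) := by
    rintro z ⟨φ, hφ, rfl⟩
    have e : (0 : E2) = pt (0 * Real.cos φ) (0 * Real.sin φ) := by
      ext i; fin_cases i <;> simp [pt]
    simp only [mem_ball]
    rw [e, dist_pt_same, sub_zero, abs_of_pos (hf_pos _ hφ)]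
    linarith [hanti Set.self_mem_Ici hφ hφ]
  have h3 : upperMink 3 Γ = 0 := three_mem_aux _ _ hbdd
  have hsub : ∀ s, upperMink s Γ = 0 → radUpperMink s Γ = 0 := by
    intro s hs
    refine le_antisymm (le_trans ?_ hs.le) (zero_le)
    refine Filter.limsup_le_limsup (Eventually.of_forall fun ε => ?_)
    exact ENNReal.div_le_div_right (measure_mono (ray_sub ε Γ)) _
  have hbdU : BddBelow {s : ℝ | 0 ≤ s ∧ upperMink s Γ = 0} := ⟨0, fun s hs => hs.1⟩
  have hbdR : BddBelow {s : ℝ | 0 ≤ s ∧ radUpperMink s Γ = 0} := ⟨0, fun s hs => hs.1⟩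
  have hneU : {s : ℝ | 0 ≤ s ∧ upperMink s Γ = 0}.Nonempty := ⟨3, by norm_num, h3⟩
  have hneR : {s : ℝ | 0 ≤ s ∧ radUpperMink s Γ = 0}.Nonempty := ⟨3, by norm_num, hsub 3 h3⟩
  have hd0 : 0 ≤ d := le_csInf hneR fun s hs => hs.1
  apply le_antisymm
  swap
  · exact csInf_le_csInf hbdR hneU fun s hs => ⟨hs.1, hsub s hs.2⟩
  refine le_of_forall_gt_imp_ge_of_dense fun s hs => ?_
  refine csInf_le hbdU ⟨by linarith, ?_⟩
  have hrad : Tendsto (fun ε : ℝ => volume (rayNbhd ε Γ) / ENNReal.ofReal (ε ^ (2 - s)))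
      (𝓝[>] (0:ℝ)) (𝓝 0) := by
    obtain ⟨s', hs', hs's⟩ := exists_lt_of_csInf_lt hneR hs
    exact tendsto_mono_aux _ s' s hs's.le ((limsup_zero_iff _).1 hs'.2)
  have hrad5 : Tendsto (fun ε : ℝ => volume (rayNbhd (5 * ε) Γ) / ENNReal.ofReal (ε ^ (2 - s)))
      (𝓝[>] (0:ℝ)) (𝓝 0) := by
    have h5 : Tendsto (fun ε : ℝ => 5 * ε) (𝓝[>] (0:ℝ)) (𝓝[>] (0:ℝ)) := by
      refine tendsto_nhdsWithin_iff.2 ⟨?_, ?_⟩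
      · have : Tendsto (fun ε : ℝ => 5 * ε) (𝓝 0) (𝓝 (5 * 0)) := tendsto_id.const_mul 5
        rw [mul_zero] at this
        exact this.mono_left nhdsWithin_le_nhds
      · filter_upwards [self_mem_nhdsWithin] with ε hε
        have hε : 0 < ε := hε
        simp only [Set.mem_Ioi]; positivity
    have h6 := ENNReal.Tendsto.mul_const (b := ENNReal.ofReal (5 ^ (2 - s))) (hrad.comp h5)
      (Or.inr ENNReal.ofReal_ne_top)
    rw [zero_mul] at h6
    refine h6.congr' ?_
    filter_upwards [self_mem_nhdsWithin] with ε hε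
    have hε : 0 < ε := hε
    have h50 : (0:ℝ) < 5 ^ (2 - s) := by positivity
    simp only [Function.comp]
    rw [Real.mul_rpow (by norm_num) hε.le, ENNReal.ofReal_mul h50.le,
      div_eq_mul_inv, div_eq_mul_inv, ENNReal.mul_inv (Or.inl (by simpa using h50))
      (Or.inl ENNReal.ofReal_ne_top)]
    have : (ENNReal.ofReal ((5:ℝ) ^ (2 - s)))⁻¹ * ENNReal.ofReal ((5:ℝ) ^ (2 - s)) = 1 :=
      ENNReal.inv_mul_cancel (by simpa using h50) ENNReal.ofReal_ne_top
    calc _ = volume (rayNbhd (5 * ε) Γ) * (ENNReal.ofReal (ε ^ (2 - s)))⁻¹ *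
          ((ENNReal.ofReal ((5:ℝ) ^ (2 - s)))⁻¹ * ENNReal.ofReal ((5:ℝ) ^ (2 - s))) := by ring
      _ = _ := by rw [this, mul_one]
  have hφ₂ge : ∀ ε, 0 < ε → φ₁ ≤ φ₂ ε := by
    intro ε hε
    rw [hφ₂]
    refine le_csInf ?_ fun φ hφ => hφ.1
    have hev : ∀ᶠ x in atTop, f x < 2 * ε := hf_lim.eventually_lt_const (by linarith)
    obtain ⟨N, hN⟩ := eventually_atTop.1 hev
    refine ⟨max φ₁ N, le_max_left _ _, fun ψ hψ => ?_⟩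
    have h1 := hN ψ ((le_max_right _ _).trans hψ)
    have h2 := hf_pos (ψ + 2 * Real.pi)
      (by have := (le_max_left φ₁ N).trans hψ; linarith [Real.pi_pos])
    linarith
  set K := 2 + 5 * f φ₁ / f (φ₁ + 1) with hK
  have hK0 : 0 ≤ K := by
    have h1 := hf_pos φ₁ le_rfl
    have h2 := hf_pos (φ₁ + 1) (by linarith)
    positivity
  set V := volume (ball (0 : E2) 1) with hV
  have hVtop : V ≠ ⊤ := measure_ball_lt_top.ne
  set g : ℝ → ℝ := fun ε => (2 * (Chi * ε ^ (1 - d / 2) * Real.log (1 / ε) ^ l)) ^ 2 with hg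
  have T1 : Tendsto (fun ε : ℝ => ENNReal.ofReal (g ε) * V / ENNReal.ofReal (ε ^ (2 - s)))
      (𝓝[>] (0:ℝ)) (𝓝 0) := by
    apply tendsto_real_aux _ _ _ hVtop
    have h := (tendsto_log_aux (s - d) (by linarith) (2 * l) (by omega)).const_mul (4 * Chi ^ 2)
    rw [mul_zero] at h
    refine h.congr' ?_
    filter_upwards [self_mem_nhdsWithin] with ε hε
    have hε : 0 < ε := hε
    have e1 : ε ^ (s - d) * ε ^ (2 - s) = (ε ^ (1 - d / 2)) ^ 2 := by
      rw [← Real.rpow_add hε, ← Real.rpow_mul_natCast hε.le]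
      congr 1; push_cast; ring
    rw [eq_div_iff (Real.rpow_pos_of_pos hε _).ne', hg]
    simp only
    rw [pow_mul']
    linear_combination (4 * Chi ^ 2 * (Real.log (1 / ε) ^ l) ^ 2) * e1
  have T2 : ∀ c : ℝ, Tendsto (fun ε : ℝ => ENNReal.ofReal ((c * ε) ^ 2) * V
      / ENNReal.ofReal (ε ^ (2 - s))) (𝓝[>] (0:ℝ)) (𝓝 0) := by
    intro c
    apply tendsto_real_aux _ _ _ hVtop
    have h := (tendsto_rpow_aux s (by linarith)).const_mul (c ^ 2)
    rw [mul_zero] at h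
    refine h.congr' ?_
    filter_upwards [self_mem_nhdsWithin] with ε hε
    have hε : 0 < ε := hε
    have e1 : ε ^ s * ε ^ (2 - s) = ε ^ 2 := by
      rw [← Real.rpow_add hε, ← Real.rpow_natCast]
      congr 1; push_cast; ring
    rw [eq_div_iff (Real.rpow_pos_of_pos hε _).ne']
    linear_combination c ^ 2 * e1
  have T := hrad5.add (T1.add ((T2 1).add (T2 K)))
  simp only [add_zero] at T
  unfold upperMink
  rw [limsup_zero_iff]
  refine tendsto_of_tendsto_of_tendsto_of_le_of_le' tendsto_const_nhds T
    (Eventually.of_forall fun _ => zero_le) ?_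
  have hsmall : ∀ᶠ ε in 𝓝[>] (0:ℝ), ε ^ (1 - q) < Clo / 2 :=
    (tendsto_rpow_aux (1 - q) (by linarith)).eventually_lt_const (by positivity)
  filter_upwards [Ioo_mem_nhdsGT hε₀, hsmall] with ε hε hs2
  have hε0 : 0 < ε := hε.1
  obtain ⟨b1, b2⟩ := hbound ε hε
  have hbig : 2 * ε ≤ f (φ₂ ε) := by
    refine le_trans ?_ b1
    have e1 : ε ^ (1 - q) * ε ^ q = ε := by
      rw [← Real.rpow_add hε0]; simp
    have := mul_lt_mul_of_pos_right hs2 (Real.rpow_pos_of_pos hε0 q)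
    linarith
  obtain ⟨z0, z1, hcov⟩ := cover_aux φ₁ f hf_pos hf_dec (φ₂ ε) ε (hφ₂ge ε hε0) hε0 hbig (hfi ε hε)
  have hvol : volume (Metric.thickening ε Γ) ≤ volume (rayNbhd (5 * ε) Γ) +
      (ENNReal.ofReal (g ε) * V + (ENNReal.ofReal ((1 * ε) ^ 2) * V
        + ENNReal.ofReal ((K * ε) ^ 2) * V)) := by
    refine (measure_mono hcov).trans ((measure_union_le _ _).trans (add_le_add le_rfl ?_))
    refine (measure_union_le _ _).trans (add_le_add ?_ ?_)
    · rw [vol_ball_aux _ _ (by linarith)]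
      refine mul_le_mul_left (ENNReal.ofReal_le_ofReal ?_) _
      exact pow_le_pow_left₀ (by linarith) (by linarith) 2
    refine (measure_union_le _ _).trans (add_le_add ?_ ?_)
    · rw [vol_ball_aux _ _ hε0.le, one_mul]
    · rw [vol_ball_aux _ _ (by positivity)]
  refine (ENNReal.div_le_div_right hvol _).trans ?_
  simp only [ENNReal.add_div]
  exact le_rfl
end
end
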